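/- Let u = x_i x_j > v = x_r x_s (i < j, r < s) be squarefree monomials of degree 2 in k[x₁,…,xₙ], and let Δ be the simplicial complex on [n] with Stanley-Reisner ideal I_Δ = (L(u,v)). Assume Δ is not Cohen-Macaulay over k. Then Δ is Buchsbaum if and only if one of the following holds: (a) u = x₁x_{n−2}, v = x_{n−2}x_{n−1}, and n > 4; or (b) u = x₁x_{n−1}, v = x_{n−2}xₙ, and n > 3. -/

import Mathlib

open Finset

/-- An abstract simplicial complex on the vertex type `V`: a collection of
finite subsets of `V` (the faces) closed under passing to subsets. -/
structure SComplex (V : Type*) where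
  faces : Set (Finset V)
  down_closed : ∀ ⦃F G : Finset V⦄, F ∈ faces → G ⊆ F → G ∈ faces

namespace SComplex

variable {V : Type*} [DecidableEq V]

/-- The vertex set of a simplicial complex. -/
def vertexSet (Δ : SComplex V) : Set V := {v | {v} ∈ Δ.faces}

/-- A facet is a maximal face. -/
def IsFacet (Δ : SComplex V) (F : Finset V) : Prop :=
  F ∈ Δ.faces ∧ ∀ G ∈ Δ.faces, F ⊆ G → F = G

/-- A complex is pure if all of its facets have the same dimension (cardinality). -/
def Pure (Δ : SComplex V) : Prop :=
  ∀ ⦃F G⦄, Δ.IsFacet F → Δ.IsFacet G → F.card = G.card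

/-- One more than the dimension: the largest cardinality of a face of `Δ`.
So `Δ.dimSucc = d` means `Δ` has dimension `d - 1`. -/
noncomputable def dimSucc (Δ : SComplex V) : ℕ :=
  sSup {n | ∃ F ∈ Δ.faces, F.card = n}

/-- The link of a face `F` : `link Δ F = {G ∈ Δ : G ∪ F ∈ Δ, G ∩ F = ∅}`. -/
def link (Δ : SComplex V) (F : Finset V) : SComplex V where
  faces := {G | G ∈ Δ.faces ∧ Disjoint G F ∧ G ∪ F ∈ Δ.faces}
  down_closed := by
    rintro G H ⟨hG, hdis, hGF⟩ hHG
    exact ⟨Δ.down_closed hG hHG, Finset.disjoint_of_subset_left hHG hdis,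
      Δ.down_closed hGF (Finset.union_subset_union_left hHG)⟩

/-- A complex is connected if it has a vertex and any two vertices are joined
by a path of edges (connectivity of the 1-skeleton). -/
def Connected (Δ : SComplex V) : Prop :=
  (∃ v, {v} ∈ Δ.faces) ∧
    ∀ a b : V, {a} ∈ Δ.faces → {b} ∈ Δ.faces →
      Relation.ReflTransGen (fun x y => x ≠ y ∧ ({x, y} : Finset V) ∈ Δ.faces) a b

/-- The join of two simplicial complexes (on disjoint vertex sets):
`Δ₁ ∗ Δ₂ = {F ∪ G : F ∈ Δ₁, G ∈ Δ₂}`. -/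
def join (Δ₁ Δ₂ : SComplex V) : SComplex V where
  faces := {H | ∃ F ∈ Δ₁.faces, ∃ G ∈ Δ₂.faces, H = F ∪ G}
  down_closed := by
    rintro H H' ⟨F, hF, G, hG, rfl⟩ hsub
    refine ⟨H' ∩ F, Δ₁.down_closed hF inter_subset_right,
      H' \ F, Δ₂.down_closed hG ?_, ?_⟩
    · intro x hx
      rcases Finset.mem_sdiff.mp hx with ⟨hx1, hx2⟩
      rcases Finset.mem_union.mp (hsub hx1) with h | h
      · exact absurd h hx2
      · exact h
    · ext x
      by_cases hx : x ∈ F <;>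
        simp only [Finset.mem_union, Finset.mem_inter, Finset.mem_sdiff, hx] <;> tauto

/-- The full simplex on a finite vertex set `W`. -/
def simplexOn (W : Finset V) : SComplex V :=
  ⟨{F | F ⊆ W}, fun _ _ hF hG => hG.trans hF⟩

/-- A shelling of `Δ`: an ordering `l` of all the facets of `Δ` such that each
facet meets the union of the previous ones in a nonempty union of
codimension-one faces of it. -/
def IsShelling (Δ : SComplex V) (l : List (Finset V)) : Prop :=
  l.Nodup ∧ (∀ F, F ∈ l ↔ Δ.IsFacet F) ∧
    ∀ i j : ℕ, j < i → i < l.length →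
      ∃ m, m < i ∧ ∃ v ∈ l[i]!,
        l[i]! ∩ l[j]! ⊆ l[i]! ∩ l[m]! ∧ l[i]! ∩ l[m]! = l[i]!.erase v

/-- A complex is shellable if its facets admit a shelling order. -/
def Shellable (Δ : SComplex V) : Prop := ∃ l, IsShelling Δ l

/-- The reduced homology `H̃₀(Δ; k)` vanishes: every `k`-linear combination of
vertices of `Δ` with coefficient sum zero is a `k`-linear combination of
boundaries of edges of `Δ`. -/
def ReducedH0Vanishes (k : Type*) [Field k] (Δ : SComplex V) : Prop :=
  ∀ f : V →₀ k, (∀ v ∈ f.support, {v} ∈ Δ.faces) → (f.sum fun _ c => c) = 0 →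
    f ∈ Submodule.span k {g : V →₀ k | ∃ a b : V, a ≠ b ∧ ({a, b} : Finset V) ∈ Δ.faces ∧
      g = Finsupp.single a 1 - Finsupp.single b 1}

end SComplex

/-- A commutative ring satisfies Serre's condition `S₂` if for every prime `p`
the localization at `p` contains, inside its maximal ideal, a regular sequence
of length at least `min 2 (dim R_p)`. -/
def RingSerreS2 (R : Type*) [CommRing R] : Prop :=
  ∀ (p : Ideal R) [p.IsPrime],
    ∃ rs : List (Localization.AtPrime p),
      (∀ r ∈ rs, r ∈ IsLocalRing.maximalIdeal (Localization.AtPrime p)) ∧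
      RingTheory.Sequence.IsRegular (Localization.AtPrime p) rs ∧
      min 2 (ringKrullDim (Localization.AtPrime p)) ≤ (rs.length : WithBot ℕ∞)

section GroundSet

/-- The squarefree monomial `∏_{i ∈ S} xᵢ` in the polynomial ring whose
variables are indexed by the ground set `W ⊆ ℕ`. -/
noncomputable def monoW (k : Type*) [CommRing k] (W S : Finset ℕ) :
    MvPolynomial {x // x ∈ W} k :=
  ∏ i ∈ S.subtype (· ∈ W), MvPolynomial.X i

/-- The Stanley–Reisner ideal of a complex `Δ` with ground (vertex) set `W ⊆ ℕ`,
inside the polynomial ring `k[xᵢ : i ∈ W]`: it is generated by the squarefree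
monomials of the non-faces contained in `W`. -/
noncomputable def srIdealW (k : Type*) [CommRing k] (W : Finset ℕ) (Δ : SComplex ℕ) :
    Ideal (MvPolynomial {x // x ∈ W} k) :=
  Ideal.span {p | ∃ F : Finset ℕ, F ⊆ W ∧ F ∉ Δ.faces ∧ p = monoW k W F}

/-- The Stanley–Reisner ring `k[Δ]` of a complex with ground set `W ⊆ ℕ`. -/
abbrev srRingW (k : Type*) [CommRing k] (W : Finset ℕ) (Δ : SComplex ℕ) :=
  MvPolynomial {x // x ∈ W} k ⧸ srIdealW k W Δ

/-- The irrelevant maximal ideal of the Stanley–Reisner ring. -/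
noncomputable def srIrrelevantW (k : Type*) [CommRing k] (W : Finset ℕ)
    (Δ : SComplex ℕ) : Ideal (srRingW k W Δ) :=
  (Ideal.span (Set.range (MvPolynomial.X : {x // x ∈ W} → MvPolynomial {x // x ∈ W} k))).map
    (Ideal.Quotient.mk (srIdealW k W Δ))

/-- `Δ` (a complex with ground set `W ⊆ ℕ`) is Cohen–Macaulay over the field `k`:
the ring `k[Δ]` admits a regular sequence, inside the irrelevant maximal ideal,
whose length equals the Krull dimension of `k[Δ]`. -/
def IsCMW (k : Type*) [Field k] (W : Finset ℕ) (Δ : SComplex ℕ) : Prop :=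
  ∃ rs : List (srRingW k W Δ), (∀ r ∈ rs, r ∈ srIrrelevantW k W Δ) ∧
    RingTheory.Sequence.IsRegular (srRingW k W Δ) rs ∧
    ringKrullDim (srRingW k W Δ) = (rs.length : WithBot ℕ∞)

/-- `Δ` is `CM_t` (Cohen–Macaulay in codimension `t`) over `k`: `Δ` is pure and
`link_Δ(F)` is Cohen–Macaulay over `k` for every face `F` with `#F ≥ t`.
`CM_1` is the Buchsbaum property. -/
def IsCMtW (k : Type*) [Field k] (W : Finset ℕ) (t : ℕ) (Δ : SComplex ℕ) : Prop :=
  Δ.Pure ∧ ∀ F ∈ Δ.faces, t ≤ F.card → IsCMW k W (Δ.link F)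

end GroundSet

section Lex

/-- Comparison of squarefree monomials of the same degree in the lexicographic
order with `x₁ > x₂ > ⋯ > xₙ`, the monomials being identified with their
supports: `u >_lex v` iff the smallest variable index where they differ
belongs to `u`. -/
def lexGT (A B : Finset ℕ) : Prop :=
  ∃ m ∈ A, m ∉ B ∧ ∀ x < m, (x ∈ A ↔ x ∈ B)

/-- `u ≥_lex v` for squarefree monomials identified with their supports. -/
def lexGE (A B : Finset ℕ) : Prop := A = B ∨ lexGT A B

/-- The lexsegment `L(u,v)` of squarefree monomials of degree `d` in
`x₁, …, xₙ`, the monomials being identified with their supports: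
all `S ⊆ [n] = {1, …, n}` with `#S = d` and `u ≥_lex S ≥_lex v`. -/
def lexSegment (n d : ℕ) (U V₀ : Finset ℕ) : Set (Finset ℕ) :=
  {S | S ⊆ Finset.Icc 1 n ∧ S.card = d ∧ lexGE U S ∧ lexGE S V₀}

/-- The ideal of `k[xᵢ : i ∈ W]` generated by the squarefree monomials of the
lexsegment `L(u,v)` (of degree-`d` squarefree monomials in `x₁, …, xₙ`). -/
noncomputable def lexIdealW (k : Type*) [CommRing k] (W : Finset ℕ) (n d : ℕ)
    (U V₀ : Finset ℕ) : Ideal (MvPolynomial {x // x ∈ W} k) :=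
  Ideal.span {p | ∃ S ∈ lexSegment n d U V₀, p = monoW k W S}

end Lex

section SequenceModIdeal

variable {S : Type*} [CommRing S]

/-- The list `rs` is a weakly regular sequence on `S ⧸ I`, phrased inside `S`. -/
def RegularModIdeal (I : Ideal S) (rs : List S) : Prop :=
  ∀ (m : ℕ) (h : m < rs.length) (a : S),
    rs[m] * a ∈ I ⊔ Ideal.ofList (rs.take m) → a ∈ I ⊔ Ideal.ofList (rs.take m)

theorem regularModIdeal_iff_isWeaklyRegular (I : Ideal S) (rs : List S) :
    RegularModIdeal I rs ↔
      RingTheory.Sequence.IsWeaklyRegular (S ⧸ I) (rs.map (Ideal.Quotient.mk I)) := by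
  have key : ∀ (J : Ideal S) (a : S),
      Ideal.Quotient.mk I a ∈ Ideal.map (Ideal.Quotient.mk I) J ↔ a ∈ I ⊔ J := by
    intro J a
    rw [sup_comm, ← Ideal.mem_quotient_iff_mem_sup]
  rw [RingTheory.Sequence.isWeaklyRegular_iff]
  simp only [List.length_map, RegularModIdeal]
  refine forall_congr' fun m => forall_congr' fun h => ?_
  rw [isSMulRegular_quotient_iff_mem_of_smul_mem]
  simp only [smul_eq_mul, Ideal.mul_top, ← List.map_take, ← Ideal.map_ofList,
    List.getElem_map]
  constructor
  · intro H x
    obtain ⟨a, rfl⟩ := Ideal.Quotient.mk_surjective x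
    rw [← map_mul, key, key]
    exact H a
  · intro H a
    have := H (Ideal.Quotient.mk I a)
    rwa [← map_mul, key, key] at this

theorem RegularModIdeal.cons {I : Ideal S} {r : S} {rs : List S}
    (hr : ∀ a, r * a ∈ I → a ∈ I) (hrs : RegularModIdeal (I ⊔ Ideal.span {r}) rs) :
    RegularModIdeal I (r :: rs) := by
  intro m h a
  cases m with
  | zero => simpa using hr a
  | succ m =>
    have := hrs m (by simpa using h) a
    simpa [sup_assoc] using this

theorem regularModIdeal_singleton {I : Ideal S} {f : S} (hf : ∀ a, f * a ∈ I → a ∈ I) :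
    RegularModIdeal I [f] :=
  .cons hf fun _ h => absurd h (by simp)

theorem regularModIdeal_pair_iff {I : Ideal S} {f g : S} :
    RegularModIdeal I [f, g] ↔ (∀ a, f * a ∈ I → a ∈ I) ∧
      ∀ a, g * a ∈ I ⊔ Ideal.span {f} → a ∈ I ⊔ Ideal.span {f} := by
  constructor
  · intro h
    exact ⟨fun a ha => by simpa using h 0 (by simp) a (by simpa using ha),
      fun a ha => by simpa using h 1 (by simp) a (by simpa using ha)⟩
  · rintro ⟨h₁, h₂⟩
    exact .cons h₁ (regularModIdeal_singleton h₂)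

theorem mem_of_mul_mem_of_colon {I J : Ideal S} {f m : S} (hJ : ∀ a, m * a ∈ I ↔ a ∈ J)
    (h₁ : ∀ a, f * a ∈ J → a ∈ J)
    (h₂ : ∀ a, f * a ∈ I ⊔ Ideal.span {m} → a ∈ I ⊔ Ideal.span {m})
    (a : S) (ha : f * a ∈ I) : a ∈ I := by
  obtain ⟨p, hp, q, hq, rfl⟩ := Submodule.mem_sup.mp (h₂ a (Ideal.mem_sup_left ha))
  obtain ⟨c, rfl⟩ := Ideal.mem_span_singleton'.mp hq
  refine I.add_mem hp ?_
  rw [mul_comm, hJ]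
  refine h₁ _ ((hJ _).mp ?_)
  have := I.sub_mem ha (I.mul_mem_left f hp)
  convert this using 1
  ring

theorem regularModIdeal_pair_of_colon {I J : Ideal S} {f g m : S}
    (hJ : ∀ a, m * a ∈ I ↔ a ∈ J) (h₁ : RegularModIdeal J [f, g])
    (h₂ : RegularModIdeal (I ⊔ Ideal.span {m}) [f, g]) : RegularModIdeal I [f, g] := by
  rw [regularModIdeal_pair_iff] at h₁ h₂ ⊢
  refine ⟨mem_of_mul_mem_of_colon hJ h₁.1 h₂.1, fun a ha => ?_⟩
  have hmem : ∀ (K : Ideal S) (x y : S), x ∈ K ⊔ Ideal.span {y} ↔ ∃ c, x - y * c ∈ K := by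
    intro K x y
    rw [sup_comm, Ideal.mem_span_singleton_sup]
    exact ⟨fun ⟨c, p, hp, h⟩ => ⟨c, by rw [← h, mul_comm y, add_sub_cancel_left]; exact hp⟩,
      fun ⟨c, hc⟩ => ⟨c, _, hc, by ring⟩⟩
  have ha' : a ∈ I ⊔ Ideal.span {m} ⊔ Ideal.span {f} :=
    h₂.2 a (by rw [sup_right_comm]; exact Ideal.mem_sup_left ha)
  obtain ⟨c, hc⟩ := (hmem _ _ _).mp ha'
  obtain ⟨h, hh⟩ := (hmem _ _ _).mp hc
  obtain ⟨b, hb⟩ := (hmem _ _ _).mp ha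
  have hb₁ : g * (m * h) - f * (b - g * c) ∈ I := by
    convert I.sub_mem hb (I.mul_mem_left g hh) using 1
    ring
  have hb₂ : b - g * c ∈ I ⊔ Ideal.span {m} := by
    refine h₂.1 _ ((hmem _ _ _).mpr ⟨g * h, ?_⟩)
    convert I.neg_mem hb₁ using 1
    ring
  obtain ⟨e, he⟩ := (hmem _ _ _).mp hb₂
  have hJ₁ : g * h - f * e ∈ J := by
    rw [← hJ]
    convert I.add_mem hb₁ (I.mul_mem_left f he) using 1
    ring
  obtain ⟨t, ht⟩ := (hmem _ _ _).mp (h₁.2 h ((hmem _ _ _).mpr ⟨e, hJ₁⟩))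
  refine (hmem _ _ _).mpr ⟨c + m * t, ?_⟩
  convert I.add_mem hh ((hJ _).mpr ht) using 1
  ring

end SequenceModIdeal

section StanleyReisnerIdeal

variable {k : Type*} [CommRing k] {W : Finset ℕ}

/-- The set of indices of the variables occurring in the monomial with exponent vector `m`. -/
def exponentSupport (m : {x // x ∈ W} →₀ ℕ) : Finset ℕ :=
  m.support.map (Function.Embedding.subtype _)

theorem mem_exponentSupport {m : {x // x ∈ W} →₀ ℕ} {v : ℕ} :
    v ∈ exponentSupport m ↔ ∃ h : v ∈ W, m ⟨v, h⟩ ≠ 0 := by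
  simp [exponentSupport]

theorem exponentSupport_subset (m : {x // x ∈ W} →₀ ℕ) : exponentSupport m ⊆ W :=
  fun _ hv => (mem_exponentSupport.mp hv).1

theorem exponentSupport_zero : exponentSupport (0 : {x // x ∈ W} →₀ ℕ) = ∅ := by
  simp [exponentSupport]

theorem exponentSupport_add (m m' : {x // x ∈ W} →₀ ℕ) :
    exponentSupport (m + m') = exponentSupport m ∪ exponentSupport m' := by
  ext v
  simp only [mem_exponentSupport, mem_union, Finsupp.add_apply]
  constructor
  · rintro ⟨h, hm⟩
    by_cases h0 : m ⟨v, h⟩ = 0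
    · exact Or.inr ⟨h, by omega⟩
    · exact Or.inl ⟨h, h0⟩
  · rintro (⟨h, hm⟩ | ⟨h, hm⟩) <;> exact ⟨h, by omega⟩

/-- The exponent vector of the squarefree monomial with support `F`. -/
noncomputable def squarefreeExponent (W F : Finset ℕ) : {x // x ∈ W} →₀ ℕ :=
  ∑ v ∈ F.subtype (· ∈ W), Finsupp.single v 1

theorem squarefreeExponent_apply (F : Finset ℕ) (v : {x // x ∈ W}) :
    squarefreeExponent W F v = if (v : ℕ) ∈ F then 1 else 0 := by
  simp [squarefreeExponent, Finsupp.finsetSum_apply, Finsupp.single_apply]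

theorem exponentSupport_squarefreeExponent {F : Finset ℕ} (hF : F ⊆ W) :
    exponentSupport (squarefreeExponent W F) = F := by
  ext v
  simp only [mem_exponentSupport, squarefreeExponent_apply]
  exact ⟨fun ⟨_, h⟩ => by by_contra h'; simp [h'] at h, fun h => ⟨hF h, by simp [h]⟩⟩

theorem squarefreeExponent_le_iff {F : Finset ℕ} (hF : F ⊆ W) {m : {x // x ∈ W} →₀ ℕ} :
    squarefreeExponent W F ≤ m ↔ F ⊆ exponentSupport m := by
  constructor
  · intro h v hv
    have := h ⟨v, hF hv⟩
    simp only [squarefreeExponent_apply, hv, if_true] at this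
    exact mem_exponentSupport.mpr ⟨hF hv, by omega⟩
  · intro h v
    rw [squarefreeExponent_apply]
    split_ifs with hv
    · obtain ⟨_, h0⟩ := mem_exponentSupport.mp (h hv)
      exact Nat.one_le_iff_ne_zero.mpr h0
    · exact Nat.zero_le _

theorem monoW_eq_monomial (F : Finset ℕ) :
    monoW k W F = MvPolynomial.monomial (squarefreeExponent W F) 1 := by
  simp only [monoW, MvPolynomial.X, squarefreeExponent]
  rw [← MvPolynomial.monomial_sum_one]

theorem monoW_singleton {v : ℕ} (hv : v ∈ W) :
    monoW k W {v} = MvPolynomial.X ⟨v, hv⟩ := by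
  have : ({v} : Finset ℕ).subtype (· ∈ W) = {⟨v, hv⟩} := by
    ext ⟨x, hx⟩
    simp
  simp [monoW, this]

theorem mem_span_monoW_iff {𝓕 : Set (Finset ℕ)} (h𝓕 : ∀ F ∈ 𝓕, F ⊆ W)
    {p : MvPolynomial {x // x ∈ W} k} :
    p ∈ Ideal.span {q | ∃ F ∈ 𝓕, q = monoW k W F} ↔
      ∀ m ∈ p.support, ∃ F ∈ 𝓕, F ⊆ exponentSupport m := by
  have : {q | ∃ F ∈ 𝓕, q = monoW k W F} =
      (fun s => MvPolynomial.monomial s (1 : k)) '' (squarefreeExponent W '' 𝓕) := by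
    ext q
    simp [monoW_eq_monomial, eq_comm]
  rw [this, MvPolynomial.mem_ideal_span_monomial_image]
  refine forall₂_congr fun m _ => ?_
  rw [Set.exists_mem_image]
  exact exists_congr fun F => and_congr_right fun hF => squarefreeExponent_le_iff (h𝓕 F hF)

theorem mem_srIdealW_iff {Δ : SComplex ℕ} {p : MvPolynomial {x // x ∈ W} k} :
    p ∈ srIdealW k W Δ ↔ ∀ m ∈ p.support, exponentSupport m ∉ Δ.faces := by
  have : {q | ∃ F : Finset ℕ, F ⊆ W ∧ F ∉ Δ.faces ∧ q = monoW k W F} =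
      {q | ∃ F ∈ {F : Finset ℕ | F ⊆ W ∧ F ∉ Δ.faces}, q = monoW k W F} := by
    simp [and_assoc]
  rw [srIdealW, this, mem_span_monoW_iff fun F hF => hF.1]
  refine forall₂_congr fun m _ => ⟨?_, fun h => ⟨_, ⟨exponentSupport_subset m, h⟩, subset_rfl⟩⟩
  rintro ⟨F, ⟨-, hF⟩, hFm⟩ hm
  exact hF (Δ.down_closed hm hFm)

theorem monoW_mem_srIdealW_iff [Nontrivial k] {Δ : SComplex ℕ} {F : Finset ℕ} (hF : F ⊆ W) :
    monoW k W F ∈ srIdealW k W Δ ↔ F ∉ Δ.faces := by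
  classical
  rw [mem_srIdealW_iff, monoW_eq_monomial, MvPolynomial.support_monomial,
    if_neg one_ne_zero]
  simp [exponentSupport_squarefreeExponent hF]

theorem X_mem_srIdealW_iff [Nontrivial k] {Δ : SComplex ℕ} {v : {x // x ∈ W}} :
    (MvPolynomial.X v : MvPolynomial {x // x ∈ W} k) ∈ srIdealW k W Δ ↔
      {(v : ℕ)} ∉ Δ.faces := by
  rw [← monoW_mem_srIdealW_iff (k := k) (W := W) (by simp), monoW_singleton v.2]

theorem srIdealW_congr {Δ Γ : SComplex ℕ} (h : ∀ F ⊆ W, F ∈ Δ.faces ↔ F ∈ Γ.faces) :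
    srIdealW k W Δ = srIdealW k W Γ := by
  ext p
  simp only [mem_srIdealW_iff]
  exact forall₂_congr fun m _ => not_congr (h _ (exponentSupport_subset m))

theorem srIdealW_anti {Δ Γ : SComplex ℕ} (h : ∀ F ⊆ W, F ∈ Δ.faces → F ∈ Γ.faces) :
    srIdealW k W Γ ≤ srIdealW k W Δ := by
  intro p hp
  rw [mem_srIdealW_iff] at hp ⊢
  exact fun m hm hm' => hp m hm (h _ (exponentSupport_subset m) hm')

theorem srIdealW_sup_span_monoW {Δ Γ : SComplex ℕ} {R : Finset ℕ} (hR : R ⊆ W)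
    (h : ∀ F ⊆ W, F ∈ Γ.faces ↔ F ∈ Δ.faces ∧ ¬ R ⊆ F) :
    srIdealW k W Δ ⊔ Ideal.span {monoW k W R} = srIdealW k W Γ := by
  have : Ideal.span {monoW k W R} =
      Ideal.span {q | ∃ F ∈ ({R} : Set (Finset ℕ)), q = monoW k W F} := by
    simp
  have h' : {q | ∃ F : Finset ℕ, F ⊆ W ∧ F ∉ Δ.faces ∧ q = monoW k W F} ∪
      {q | ∃ F ∈ ({R} : Set (Finset ℕ)), q = monoW k W F} =
      {q | ∃ F ∈ {F : Finset ℕ | F ⊆ W ∧ (F ∉ Δ.faces ∨ F = R)}, q = monoW k W F} := by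
    ext q
    simp only [Set.mem_union, Set.mem_ofPred_eq, Set.mem_singleton_iff]
    constructor
    · rintro (⟨F, h1, h2, rfl⟩ | ⟨F, rfl, rfl⟩)
      · exact ⟨F, ⟨h1, Or.inl h2⟩, rfl⟩
      · exact ⟨F, ⟨hR, Or.inr rfl⟩, rfl⟩
    · rintro ⟨F, ⟨h1, h2 | h2⟩, rfl⟩
      · exact Or.inl ⟨F, h1, h2, rfl⟩
      · exact Or.inr ⟨F, h2, rfl⟩
  ext p
  rw [this, srIdealW, ← Ideal.span_union, h', mem_span_monoW_iff fun F hF => hF.1,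
    mem_srIdealW_iff]
  refine forall₂_congr fun m _ => ?_
  rw [h _ (exponentSupport_subset m), not_and_or, not_not]
  constructor
  · rintro ⟨F, ⟨-, hF | rfl⟩, hFm⟩
    · exact Or.inl fun hm => hF (Δ.down_closed hm hFm)
    · exact Or.inr hFm
  · rintro (hm | hm)
    · exact ⟨_, ⟨exponentSupport_subset m, Or.inl hm⟩, subset_rfl⟩
    · exact ⟨R, ⟨hR, Or.inr rfl⟩, hm⟩

theorem monoW_mul_mem_srIdealW_iff {Δ Γ : SComplex ℕ} {R : Finset ℕ} (hR : R ⊆ W)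
    (h : ∀ F ⊆ W, F ∪ R ∈ Δ.faces ↔ F ∈ Γ.faces) (p : MvPolynomial {x // x ∈ W} k) :
    monoW k W R * p ∈ srIdealW k W Δ ↔ p ∈ srIdealW k W Γ := by
  rw [mem_srIdealW_iff, mem_srIdealW_iff, monoW_eq_monomial, mul_comm]
  constructor
  · intro H m hm hmΓ
    refine H (m + squarefreeExponent W R) ?_ ?_
    · rwa [MvPolynomial.mem_support_iff, MvPolynomial.coeff_mul_monomial, mul_one,
        ← MvPolynomial.mem_support_iff]
    · rw [exponentSupport_add, exponentSupport_squarefreeExponent hR]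
      exact (h _ (exponentSupport_subset m)).mpr hmΓ
  · intro H m hm hmΔ
    rw [MvPolynomial.mem_support_iff, MvPolynomial.coeff_mul_monomial'] at hm
    split_ifs at hm with hle
    · refine H (m - squarefreeExponent W R) ?_ ?_
      · rw [MvPolynomial.mem_support_iff]
        simpa using hm
      · rw [← h _ (exponentSupport_subset _)]
        rw [← tsub_add_cancel_of_le hle, exponentSupport_add,
          exponentSupport_squarefreeExponent hR] at hmΔ
        exact hmΔ
    · exact hm rfl

theorem X_mul_mem_srIdealW_iff {Δ : SComplex ℕ} {c : ℕ} (hc : c ∈ W)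
    (hcone : ∀ F ∈ Δ.faces, insert c F ∈ Δ.faces) (p : MvPolynomial {x // x ∈ W} k) :
    MvPolynomial.X ⟨c, hc⟩ * p ∈ srIdealW k W Δ ↔ p ∈ srIdealW k W Δ := by
  rw [← monoW_singleton hc]
  refine monoW_mul_mem_srIdealW_iff (by simpa using hc) (fun F _ => ?_) p
  rw [union_comm, ← insert_eq]
  exact ⟨fun h => Δ.down_closed h (subset_insert _ _), hcone F⟩

/-- Restriction of polynomials to the coordinate subspace spanned by `F`. -/
noncomputable def restrictToFace (k : Type*) [CommRing k] (W F : Finset ℕ) :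
    MvPolynomial {x // x ∈ W} k →ₐ[k] MvPolynomial {x // x ∈ F} k :=
  MvPolynomial.aeval fun v => if h : (v : ℕ) ∈ F then MvPolynomial.X ⟨v, h⟩ else 0

theorem restrictToFace_surjective {F : Finset ℕ} (hF : F ⊆ W) :
    Function.Surjective (restrictToFace k W F) := by
  intro p
  refine ⟨MvPolynomial.rename (fun v => ⟨v, hF v.2⟩) p, ?_⟩
  have : (restrictToFace k W F).comp
      (MvPolynomial.rename fun v : {x // x ∈ F} => (⟨v, hF v.2⟩ : {x // x ∈ W})) =
      AlgHom.id k _ := by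
    ext v : 1
    simp [restrictToFace]
  exact DFunLike.congr_fun this p

theorem restrictToFace_eq_zero_of_mem {Δ : SComplex ℕ} {F : Finset ℕ} (hF : F ∈ Δ.faces)
    {p : MvPolynomial {x // x ∈ W} k} (hp : p ∈ srIdealW k W Δ) :
    restrictToFace k W F p = 0 := by
  have : srIdealW k W Δ ≤ RingHom.ker (restrictToFace k W F) := by
    refine Ideal.span_le.mpr ?_
    rintro _ ⟨G, hGW, hG, rfl⟩
    have : ∃ v ∈ G, v ∉ F := by
      by_contra! hGF
      exact hG (Δ.down_closed hF hGF)
    obtain ⟨v, hvG, hvF⟩ := this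
    simp only [SetLike.mem_coe, RingHom.mem_ker, monoW, map_prod]
    refine Finset.prod_eq_zero (i := ⟨v, hGW hvG⟩) (by simpa using hvG) ?_
    simp [restrictToFace, hvF]
  exact this hp

theorem mem_srIdealW_simplexOn_iff {F : Finset ℕ} (hF : F ⊆ W)
    {p : MvPolynomial {x // x ∈ W} k} :
    p ∈ srIdealW k W (SComplex.simplexOn F) ↔ restrictToFace k W F p = 0 := by
  refine ⟨restrictToFace_eq_zero_of_mem (Δ := SComplex.simplexOn F) (F := F)
    (show F ⊆ F from subset_rfl), fun hp => ?_⟩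
  nontriviality k
  let mk := Ideal.Quotient.mkₐ k (srIdealW k W (SComplex.simplexOn F))
  have : (mk.comp (MvPolynomial.rename
      fun v : {x // x ∈ F} => (⟨v, hF v.2⟩ : {x // x ∈ W}))).comp (restrictToFace k W F) = mk := by
    ext v : 1
    by_cases hv : (v : ℕ) ∈ F
    · simp [restrictToFace, hv]
    · simp only [restrictToFace, AlgHom.coe_comp, Function.comp_apply, MvPolynomial.aeval_X, hv,
        dite_false, map_zero]
      refine (Ideal.Quotient.eq_zero_iff_mem.mpr ?_).symm
      rw [X_mem_srIdealW_iff]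
      simpa [SComplex.simplexOn] using hv
  have h := DFunLike.congr_fun this p
  rw [AlgHom.comp_apply, hp, map_zero] at h
  exact Ideal.Quotient.eq_zero_iff_mem.mp h.symm

end StanleyReisnerIdeal

section CohenMacaulay

variable {k : Type*} [Field k] {W : Finset ℕ}

theorem ringKrullDim_srRingW {Δ : SComplex ℕ} {d : ℕ}
    (hle : ∀ F ∈ Δ.faces, F ⊆ W → F.card ≤ d) {F₀ : Finset ℕ} (hF₀ : F₀ ∈ Δ.faces)
    (hF₀W : F₀ ⊆ W) (hcard : F₀.card = d) :
    ringKrullDim (srRingW k W Δ) = d := by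
  have hdim : ∀ F : Finset ℕ, ringKrullDim (MvPolynomial {x // x ∈ F} k) = (F.card : ℕ) := by
    intro F
    rw [MvPolynomial.ringKrullDim_of_isNoetherianRing, ringKrullDim_eq_zero_of_field, zero_add,
      Nat.card_eq_fintype_card, Fintype.card_coe]
  refine le_antisymm ?_ ?_
  · rw [ringKrullDim_quotient]
    refine iSup_le fun l => ?_
    let P := l.head.1.asIdeal
    have hP : srIdealW k W Δ ≤ P := l.head.2
    classical
    let F : Finset ℕ := W.filter fun v =>
      ∃ h : v ∈ W, (MvPolynomial.X ⟨v, h⟩ : MvPolynomial {x // x ∈ W} k) ∉ P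
    have hFW : F ⊆ W := filter_subset _ _
    have hF : F ∈ Δ.faces := by
      by_contra hF
      have : monoW k W F ∈ P := hP ((monoW_mem_srIdealW_iff hFW).mpr hF)
      obtain ⟨v, hv, hvP⟩ := (Ideal.IsPrime.prod_mem_iff (hp := l.head.1.isPrime)).mp this
      obtain ⟨-, h, hv'⟩ := mem_filter.mp (mem_subtype.mp hv)
      exact hv' hvP
    have hle' : srIdealW k W (SComplex.simplexOn F) ≤ P := by
      refine Ideal.span_le.mpr ?_
      rintro _ ⟨G, hGW, hG, rfl⟩
      obtain ⟨v, hvG, hvF⟩ := not_subset.mp (show ¬ G ⊆ F from hG)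
      have hvP : (MvPolynomial.X ⟨v, hGW hvG⟩ : MvPolynomial {x // x ∈ W} k) ∈ P := by
        by_contra hvP
        exact hvF (mem_filter.mpr ⟨hGW hvG, hGW hvG, hvP⟩)
      exact P.mem_of_dvd (Finset.dvd_prod_of_mem _ (by simpa using hvG)) hvP
    have hup : ∀ a, srIdealW k W (SComplex.simplexOn F) ≤ (l a).1.asIdeal := fun a =>
      hle'.trans (show l.head ≤ l a from l.monotone (Fin.zero_le a))
    let l' : LTSeries (PrimeSpectrum.zeroLocus
        (srIdealW k W (SComplex.simplexOn F) : Set (MvPolynomial {x // x ∈ W} k))) :=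
      ⟨l.length, fun a => ⟨(l a).1, hup a⟩, fun a => l.step a⟩
    have h₁ : (l.length : WithBot ℕ∞) ≤
        ringKrullDim (srRingW k W (SComplex.simplexOn F)) := by
      rw [ringKrullDim_quotient]
      exact Order.LTSeries.length_le_krullDim l'
    have h₂ : ringKrullDim (srRingW k W (SComplex.simplexOn F)) ≤ (F.card : ℕ) := by
      rw [← hdim F]
      let e := Ideal.quotientKerAlgEquivOfSurjective (restrictToFace_surjective (k := k) hFW)
      have he : srIdealW k W (SComplex.simplexOn F) = RingHom.ker (restrictToFace k W F) := by
        ext p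
        rw [mem_srIdealW_simplexOn_iff hFW, RingHom.mem_ker]
      change ringKrullDim (_ ⧸ srIdealW k W (SComplex.simplexOn F)) ≤ _
      rw [he]
      exact (ringKrullDim_eq_of_ringEquiv e.toRingEquiv).le
    exact h₁.trans (h₂.trans (by exact_mod_cast hle F hF hFW))
  · rw [← hcard, ← hdim F₀]
    refine ringKrullDim_le_of_surjective
      (Ideal.Quotient.lift (srIdealW k W Δ) (restrictToFace k W F₀ : _ →+* _)
        fun a ha => restrictToFace_eq_zero_of_mem hF₀ ha) ?_
    exact Ideal.Quotient.lift_surjective_of_surjective _ _ (restrictToFace_surjective hF₀W)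

theorem isCMW_iff {Δ : SComplex ℕ} (hΔ : ∅ ∈ Δ.faces) :
    IsCMW k W Δ ↔ ∃ rs : List (MvPolynomial {x // x ∈ W} k),
      (∀ r ∈ rs, r ∈ Ideal.span (Set.range MvPolynomial.X)) ∧
      RegularModIdeal (srIdealW k W Δ) rs ∧
      ringKrullDim (srRingW k W Δ) = (rs.length : WithBot ℕ∞) := by
  constructor
  · rintro ⟨rs, hmem, hreg, hdim⟩
    have : ∀ r ∈ rs, ∃ s ∈ Ideal.span (Set.range
        (MvPolynomial.X : {x // x ∈ W} → MvPolynomial {x // x ∈ W} k)),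
        Ideal.Quotient.mk (srIdealW k W Δ) s = r := fun r hr =>
      (Ideal.mem_map_iff_of_surjective _ Ideal.Quotient.mk_surjective).mp (hmem r hr)
    choose! g hg₁ hg₂ using this
    have hrs : (rs.map g).map (Ideal.Quotient.mk (srIdealW k W Δ)) = rs := by
      rw [List.map_map]
      exact (List.map_congr_left fun r hr => hg₂ r hr).trans (List.map_id' rs)
    refine ⟨rs.map g, ?_, ?_, by simpa using hdim⟩
    · simpa using hg₁
    · rw [regularModIdeal_iff_isWeaklyRegular, hrs]
      exact hreg.toIsWeaklyRegular
  · rintro ⟨rs, hmem, hreg, hdim⟩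
    refine ⟨rs.map (Ideal.Quotient.mk _), ?_,
      ⟨(regularModIdeal_iff_isWeaklyRegular _ _).mp hreg, ?_⟩, by simpa using hdim⟩
    · intro r hr
      obtain ⟨s, hs, rfl⟩ := List.mem_map.mp hr
      exact Ideal.mem_map_of_mem _ (hmem s hs)
    · intro htop
      rw [smul_eq_mul, Ideal.mul_top, ← Ideal.map_ofList] at htop
      have h1 : Ideal.Quotient.mk (srIdealW k W Δ) 1 ∈
          Ideal.map (Ideal.Quotient.mk (srIdealW k W Δ)) (Ideal.ofList rs) := by
        rw [← htop]
        trivial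
      rw [Ideal.mem_quotient_iff_mem_sup] at h1
      have hle : Ideal.ofList rs ⊔ srIdealW k W Δ ≤
          RingHom.ker (MvPolynomial.constantCoeff (R := k) (σ := {x // x ∈ W})) := by
        refine sup_le (Ideal.span_le.mpr fun r hr => ?_) fun p hp => ?_
        · refine (Ideal.span_le.mpr ?_ : Ideal.span (Set.range MvPolynomial.X) ≤ _) (hmem r hr)
          rintro _ ⟨v, rfl⟩
          simp [RingHom.mem_ker]
        · rw [RingHom.mem_ker, MvPolynomial.constantCoeff_eq]
          by_contra h0
          refine mem_srIdealW_iff.mp hp 0 (MvPolynomial.mem_support_iff.mpr h0) ?_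
          rwa [exponentSupport_zero]
      have := hle h1
      simp [RingHom.mem_ker] at this

theorem exists_face_card_max {Δ : SComplex ℕ} (hΔ : ∅ ∈ Δ.faces) (W : Finset ℕ) :
    ∃ F ∈ Δ.faces, F ⊆ W ∧ ∀ G ∈ Δ.faces, G ⊆ W → G.card ≤ F.card := by
  classical
  obtain ⟨F, hF, hmax⟩ := (W.powerset.filter (· ∈ Δ.faces)).exists_max_image Finset.card
    ⟨∅, by simpa using hΔ⟩
  simp only [mem_filter, mem_powerset] at hF hmax
  exact ⟨F, hF.2, hF.1, fun G hG hGW => hmax G ⟨hGW, hG⟩⟩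

/-- A cone is Cohen–Macaulay if the link of its apex is. -/
theorem isCMW_of_isCMW_link {Δ : SComplex ℕ} {c : ℕ} (hc : c ∈ W) (hΔ : ∅ ∈ Δ.faces)
    (hcone : ∀ F ∈ Δ.faces, insert c F ∈ Δ.faces) (hlink : IsCMW k W (Δ.link {c})) :
    IsCMW k W Δ := by
  have hmem : ∀ F, F ∈ (Δ.link {c}).faces ↔ F ∈ Δ.faces ∧ c ∉ F := by
    intro F
    simp only [SComplex.link, Set.mem_ofPred_eq, disjoint_singleton_right]
    refine ⟨fun h => ⟨h.1, h.2.1⟩, fun h => ⟨h.1, h.2, ?_⟩⟩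
    rw [union_comm, ← insert_eq]
    exact hcone F h.1
  have hempty : ∅ ∈ (Δ.link {c}).faces := (hmem _).mpr ⟨hΔ, by simp⟩
  obtain ⟨rs, hrs, hreg, hdim⟩ := (isCMW_iff hempty).mp hlink
  obtain ⟨F, hF, hFW, hmax⟩ := exists_face_card_max hempty W
  rw [ringKrullDim_srRingW (fun G hG hGW => hmax G hG hGW) hF hFW rfl] at hdim
  have hlen : F.card = rs.length := by exact_mod_cast hdim
  obtain ⟨hFΔ, hcF⟩ := (hmem F).mp hF
  refine (isCMW_iff hΔ).mpr ⟨MvPolynomial.X ⟨c, hc⟩ :: rs, ?_, .cons ?_ ?_, ?_⟩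
  · intro r hr
    rcases List.mem_cons.mp hr with rfl | hr
    · exact Ideal.subset_span ⟨_, rfl⟩
    · exact hrs r hr
  · exact fun a ha => (X_mul_mem_srIdealW_iff hc hcone a).mp ha
  · rw [← monoW_singleton hc,
      srIdealW_sup_span_monoW (Γ := Δ.link {c}) (by simpa using hc) fun G _ => by simp [hmem G]]
    exact hreg
  · rw [List.length_cons, ← hlen]
    refine ringKrullDim_srRingW (F₀ := insert c F) (fun G hG hGW => ?_) (hcone F hFΔ)
      (insert_subset hc hFW) (card_insert_of_notMem hcF)
    have := hmax (G.erase c) ((hmem _).mpr ⟨Δ.down_closed hG (erase_subset _ _), by simp⟩)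
      ((erase_subset _ _).trans hGW)
    have := G.pred_card_le_card_erase (a := c)
    omega

end CohenMacaulay

section Graphs

variable {k : Type*} [Field k] {W : Finset ℕ}

/-- The sum of the variables indexed by `A`. -/
noncomputable def linearForm (k : Type*) [CommRing k] (W A : Finset ℕ) :
    MvPolynomial {x // x ∈ W} k :=
  ∑ v ∈ A.subtype (· ∈ W), MvPolynomial.X v

theorem linearForm_mem_span (A : Finset ℕ) :
    linearForm k W A ∈ Ideal.span (Set.range MvPolynomial.X) :=
  Ideal.sum_mem _ fun _ _ => Ideal.subset_span ⟨_, rfl⟩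

theorem linearForm_sub_X_mem {A e : Finset ℕ} {a : ℕ} (haW : a ∈ W) (ha : a ∈ A)
    (hAe : ∀ v ∈ A, v ∈ e → v = a) :
    linearForm k W A - MvPolynomial.X ⟨a, haW⟩ ∈ srIdealW k W (SComplex.simplexOn e) := by
  rw [linearForm, ← Finset.add_sum_erase _ _
    (show (⟨a, haW⟩ : {x // x ∈ W}) ∈ A.subtype (· ∈ W) by simpa using ha), add_sub_cancel_left]
  refine Ideal.sum_mem _ fun v hv => ?_
  rw [X_mem_srIdealW_iff]
  simp only [mem_erase, mem_subtype] at hv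
  intro hve
  exact hv.1 (Subtype.ext (hAe v hv.2 (singleton_subset_iff.mp hve)))

theorem mem_of_linearForm_mul_mem {A e : Finset ℕ} {a : ℕ} (haW : a ∈ W) (ha : a ∈ A)
    (hae : a ∈ e) (hAe : ∀ v ∈ A, v ∈ e → v = a) (p : MvPolynomial {x // x ∈ W} k)
    (hp : linearForm k W A * p ∈ srIdealW k W (SComplex.simplexOn e)) :
    p ∈ srIdealW k W (SComplex.simplexOn e) := by
  rw [← X_mul_mem_srIdealW_iff (Δ := SComplex.simplexOn e) haW
    fun F (hF : F ⊆ e) => insert_subset hae hF]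
  convert Ideal.sub_mem _ hp (Ideal.mul_mem_right p _ (linearForm_sub_X_mem haW ha hAe)) using 1
  ring

theorem regularModIdeal_simplexOn_pair {A B e : Finset ℕ} {a b : ℕ} (he : e ⊆ W)
    (ha : a ∈ A) (hae : a ∈ e) (hAe : ∀ v ∈ A, v ∈ e → v = a)
    (hb : b ∈ B) (hbe : b ∈ e) (hBe : ∀ v ∈ B, v ∈ e → v = b) (hab : a ≠ b) :
    RegularModIdeal (srIdealW k W (SComplex.simplexOn e)) [linearForm k W A, linearForm k W B] := by
  rw [regularModIdeal_pair_iff]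
  refine ⟨mem_of_linearForm_mul_mem (he hae) ha hae hAe, ?_⟩
  have hsup : srIdealW k W (SComplex.simplexOn e) ⊔ Ideal.span {linearForm k W A} =
      srIdealW k W (SComplex.simplexOn (e.erase a)) := by
    rw [← srIdealW_sup_span_monoW (Δ := SComplex.simplexOn e)
      (Γ := SComplex.simplexOn (e.erase a)) (R := {a}) (by simpa using he hae) fun F _ => ?_,
      monoW_singleton (he hae)]
    · have hmem := linearForm_sub_X_mem (k := k) (he hae) ha hAe
      apply le_antisymm <;> refine sup_le le_sup_left ?_ <;>
        rw [Ideal.span_singleton_le_iff_mem]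
      · rw [← sub_add_cancel (linearForm k W A) (MvPolynomial.X ⟨a, he hae⟩)]
        exact Ideal.add_mem _ (Ideal.mem_sup_left hmem)
          (Ideal.mem_sup_right (Ideal.mem_span_singleton_self _))
      · rw [← sub_sub_cancel (linearForm k W A) (MvPolynomial.X ⟨a, he hae⟩)]
        exact Ideal.sub_mem _ (Ideal.mem_sup_right (Ideal.mem_span_singleton_self _))
          (Ideal.mem_sup_left hmem)
    · simp [SComplex.simplexOn, subset_erase]
  rw [hsup]
  exact mem_of_linearForm_mul_mem (he hbe) hb (mem_erase.mpr ⟨hab.symm, hbe⟩)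
    fun v hv hve => hBe v hv (mem_of_mem_erase hve)

/-- The simplicial complex generated by a family of sets. -/
def generatedComplex (E : Set (Finset ℕ)) : SComplex ℕ where
  faces := {F | ∃ e ∈ E, F ⊆ e}
  down_closed := fun _ _ ⟨e, he, hF⟩ hG => ⟨e, he, hG.trans hF⟩

/-- Adding one more facet in a shelling preserves regular sequences of length two. -/
theorem regularModIdeal_generatedComplex_insert {E : Set (Finset ℕ)} {e R : Finset ℕ}
    {f g : MvPolynomial {x // x ∈ W} k} (heW : e ⊆ W) (hRe : R ⊆ e) (hnew : ∀ e' ∈ E, ¬ R ⊆ e')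
    (hold : ∀ v ∈ R, ∃ e' ∈ E, e.erase v ⊆ e')
    (he : RegularModIdeal (srIdealW k W (SComplex.simplexOn e)) [f, g])
    (hE : RegularModIdeal (srIdealW k W (generatedComplex E)) [f, g]) :
    RegularModIdeal (srIdealW k W (generatedComplex (insert e E))) [f, g] := by
  refine regularModIdeal_pair_of_colon (m := monoW k W R)
    (monoW_mul_mem_srIdealW_iff (Γ := SComplex.simplexOn e) (hRe.trans heW) fun F _ => ?_) he ?_
  · constructor
    · rintro ⟨e', rfl | he', hF⟩
      · exact subset_union_left.trans hF
      · exact absurd (subset_union_right.trans hF) (hnew _ he')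
    · exact fun hF => ⟨e, Or.inl rfl, union_subset hF hRe⟩
  · rwa [srIdealW_sup_span_monoW (Γ := generatedComplex E) (hRe.trans heW) fun F _ => ?_]
    constructor
    · rintro ⟨e', he', hF⟩
      exact ⟨⟨e', Or.inr he', hF⟩, fun hRF => hnew e' he' (hRF.trans hF)⟩
    · rintro ⟨⟨e', rfl | he', hF⟩, hRF⟩
      · obtain ⟨v, hvR, hvF⟩ := not_subset.mp hRF
        obtain ⟨e'', he'', hv⟩ := hold v hvR
        exact ⟨e'', he'', (subset_erase.mpr ⟨hF, hvF⟩).trans hv⟩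
      · exact ⟨e', he', hF⟩

theorem regularModIdeal_generatedComplex_singleton {e : Finset ℕ}
    {rs : List (MvPolynomial {x // x ∈ W} k)}
    (he : RegularModIdeal (srIdealW k W (SComplex.simplexOn e)) rs) :
    RegularModIdeal (srIdealW k W (generatedComplex {e})) rs := by
  rwa [srIdealW_congr (Γ := SComplex.simplexOn e) fun F _ => ?_]
  simp [generatedComplex, SComplex.simplexOn]

/-- Attaching leaves to a vertex of a graph preserves regular sequences of length two. -/
theorem regularModIdeal_generatedComplex_leaves {E : Set (Finset ℕ)} {c : ℕ} {L : Finset ℕ}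
    {f g : MvPolynomial {x // x ∈ W} k} (hc : c ∈ W) (hL : L ⊆ W)
    (hcE : ∃ e ∈ E, c ∈ e) (hLE : ∀ a ∈ L, ∀ e ∈ E, a ∉ e) (hcL : c ∉ L)
    (hreg : ∀ a ∈ L, RegularModIdeal (srIdealW k W (SComplex.simplexOn {c, a})) [f, g])
    (hE : RegularModIdeal (srIdealW k W (generatedComplex E)) [f, g]) :
    RegularModIdeal (srIdealW k W
      (generatedComplex (E ∪ {e | ∃ a ∈ L, e = {c, a}}))) [f, g] := by
  induction L using Finset.induction_on with
  | empty => simpa using hE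
  | insert a L haL ih =>
    have ih' := ih ((subset_insert _ _).trans hL) (fun b hb => hLE b (mem_insert_of_mem hb))
      (fun h => hcL (mem_insert_of_mem h)) (fun b hb => hreg b (mem_insert_of_mem hb))
    have haW : a ∈ W := hL (mem_insert_self _ _)
    have hca : a ≠ c := fun h => hcL (h ▸ mem_insert_self _ _)
    have : (E ∪ {e | ∃ b ∈ insert a L, e = {c, b}}) =
        insert {c, a} (E ∪ {e | ∃ b ∈ L, e = ({c, b} : Finset ℕ)}) := by
      ext e
      simp only [Set.mem_union, Set.mem_ofPred_eq, Set.mem_insert_iff, mem_insert,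
        exists_eq_or_imp]
      tauto
    rw [this]
    refine regularModIdeal_generatedComplex_insert (R := {a}) ?_ (by simp) ?_ ?_
      (hreg a (mem_insert_self _ _)) ih'
    · exact insert_subset hc (by simpa using haW)
    · rintro e' (he' | ⟨b, hb, rfl⟩)
      · simpa using hLE a (mem_insert_self _ _) e' he'
      · have hab : a ≠ b := fun h => haL (h ▸ hb)
        simp [hab, hca]
    · intro v hv
      obtain ⟨e, he, hce⟩ := hcE
      refine ⟨e, Or.inl he, fun x hx => ?_⟩
      rw [mem_singleton] at hv
      simp only [hv, mem_erase, mem_insert, mem_singleton] at hx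
      rcases hx with ⟨hxa, rfl | rfl⟩
      · exact hce
      · exact absurd rfl hxa

theorem isCMW_generatedComplex_of_regularModIdeal {E : Set (Finset ℕ)} {d : ℕ}
    {rs : List (MvPolynomial {x // x ∈ W} k)} (hE : E.Nonempty) (hEW : ∀ e ∈ E, e ⊆ W)
    (hcard : ∀ e ∈ E, e.card = d) (hlen : rs.length = d)
    (hrs : ∀ r ∈ rs, r ∈ Ideal.span (Set.range MvPolynomial.X))
    (hreg : RegularModIdeal (srIdealW k W (generatedComplex E)) rs) :
    IsCMW k W (generatedComplex E) := by
  obtain ⟨e, he⟩ := hE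
  refine (isCMW_iff (Δ := generatedComplex E) ⟨e, he, empty_subset _⟩).mpr ⟨rs, hrs, hreg, ?_⟩
  rw [hlen]
  refine ringKrullDim_srRingW ?_ ⟨e, he, subset_rfl⟩ (hEW e he) (hcard e he)
  rintro F ⟨e', he', hF⟩ -
  exact (card_le_card hF).trans (hcard e' he').le

/-- A nonempty complex of dimension zero is Cohen–Macaulay. -/
theorem isCMW_of_card_le_one {Δ : SComplex ℕ} (hΔW : ∀ F ∈ Δ.faces, F ⊆ W)
    (hcard : ∀ F ∈ Δ.faces, F.card ≤ 1) {v : ℕ} (hv : {v} ∈ Δ.faces) : IsCMW k W Δ := by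
  refine (isCMW_iff (Δ.down_closed hv (empty_subset _))).mpr
    ⟨[linearForm k W W], by simpa using linearForm_mem_span W,
      regularModIdeal_singleton fun p hp => ?_,
      by simpa using ringKrullDim_srRingW (k := k) (fun F hF _ => hcard F hF) hv (hΔW _ hv) rfl⟩
  rw [mem_srIdealW_iff]
  intro m hm hmΔ
  have : ∃ w, {w} ∈ Δ.faces ∧ exponentSupport m ⊆ {w} := by
    rcases (exponentSupport m).eq_empty_or_nonempty with h | ⟨w, hw⟩
    · exact ⟨v, hv, by simp [h]⟩
    · have h := eq_of_subset_of_card_le (singleton_subset_iff.mpr hw)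
        (by simpa using hcard _ hmΔ)
      exact ⟨w, h ▸ hmΔ, h.ge⟩
  obtain ⟨w, hw, hmw⟩ := this
  have hwW : w ∈ W := by simpa using hΔW _ hw
  have hp' : linearForm k W W * p ∈ srIdealW k W (SComplex.simplexOn {w}) :=
    srIdealW_anti (Δ := SComplex.simplexOn {w}) (fun F _ (hF : F ⊆ {w}) => Δ.down_closed hw hF) hp
  exact mem_srIdealW_iff.mp (mem_of_linearForm_mul_mem hwW hwW (mem_singleton_self w)
    (fun x _ hx => mem_singleton.mp hx) p hp') m hm hmw

theorem isCMW_of_faces_eq_empty {Δ : SComplex ℕ} (hΔ : ∅ ∈ Δ.faces)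
    (h : ∀ F ∈ Δ.faces, F = ∅) : IsCMW k W Δ := by
  refine (isCMW_iff hΔ).mpr ⟨[], by simp, fun m hm => ?_, ?_⟩
  · simp at hm
  · simpa using ringKrullDim_srRingW (k := k) (d := 0)
      (fun F hF _ => by rw [h F hF, card_empty]) hΔ (empty_subset W) rfl

/-- A pure complex of dimension one is Buchsbaum. -/
theorem isCMtW_one_of_graph {Δ : SComplex ℕ} (hΔW : ∀ F ∈ Δ.faces, F ⊆ W)
    (hcard : ∀ F ∈ Δ.faces, F.card ≤ 2)
    (hext : ∀ F ∈ Δ.faces, ∃ G ∈ Δ.faces, F ⊆ G ∧ G.card = 2) : IsCMtW k W 1 Δ := by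
  refine ⟨fun F G hF hG => ?_, fun F hF hF1 => ?_⟩
  · have h2 : ∀ F, Δ.IsFacet F → F.card = 2 := fun F hF => by
      obtain ⟨G, hG, hFG, hG2⟩ := hext F hF.1
      rwa [hF.2 G hG hFG]
    rw [h2 F hF, h2 G hG]
  · have hlinkcard : ∀ G ∈ (Δ.link F).faces, G.card + F.card ≤ 2 := by
      rintro G ⟨-, hdis, hGF⟩
      rw [← card_union_of_disjoint hdis]
      exact hcard _ hGF
    have hempty : ∅ ∈ (Δ.link F).faces :=
      ⟨Δ.down_closed hF (empty_subset _), disjoint_empty_left _, by simpa using hF⟩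
    by_cases hF2 : F.card = 2
    · refine isCMW_of_faces_eq_empty hempty fun G hG => ?_
      have := hlinkcard G hG
      exact card_eq_zero.mp (by omega)
    · obtain ⟨G, hG, hFG, hG2⟩ := hext F hF
      have hF' := hcard F hF
      obtain ⟨v, hv⟩ := card_eq_one.mp
        (show (G \ F).card = 1 by rw [card_sdiff_of_subset hFG]; omega)
      refine isCMW_of_card_le_one (fun G' hG' => hΔW _ hG'.1)
        (fun G' hG' => by have := hlinkcard G' hG'; omega) (v := v) ?_
      rw [← hv]
      exact ⟨Δ.down_closed hG sdiff_subset, sdiff_disjoint, by rwa [sdiff_union_of_subset hFG]⟩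

end Graphs

section FlagComplexes

/-- The pairs `{a, b}` with `1 ≤ a < b ≤ n` which are not edges of the graph `P`. -/
def nonedges (n : ℕ) (P : ℕ → ℕ → Prop) : Set (Finset ℕ) :=
  {e | ∃ a b, 1 ≤ a ∧ a < b ∧ b ≤ n ∧ ¬ P a b ∧ e = {a, b}}

/-- `Δ` is the complex on `{1, …, n}` of independent sets of the graph whose edges are the pairs
`a < b` with `P a b`. -/
def IsIndependenceComplex (n : ℕ) (P : ℕ → ℕ → Prop) (Δ : SComplex ℕ) : Prop :=
  ∀ F, F ∈ Δ.faces ↔ F ⊆ Icc 1 n ∧ ∀ a ∈ F, ∀ b ∈ F, a < b → ¬ P a b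

variable {n : ℕ} {P : ℕ → ℕ → Prop} {Δ : SComplex ℕ}

theorem card_le_two_of_forall_lt {F : Finset ℕ}
    (h : ∀ a ∈ F, ∀ b ∈ F, ∀ c ∈ F, a < b → b < c → False) : F.card ≤ 2 := by
  by_contra! hF
  have hne : F.Nonempty := card_pos.mp (by omega)
  obtain ⟨b, hb, hb'⟩ := exists_mem_notMem_of_card_lt_card
    (lt_of_le_of_lt (card_le_two (a := F.min' hne) (b := F.max' hne)) hF)
  simp only [mem_insert, mem_singleton, not_or] at hb'
  exact h _ (F.min'_mem hne) b hb _ (F.max'_mem hne)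
    (lt_of_le_of_ne (F.min'_le b hb) (Ne.symm hb'.1))
    (lt_of_le_of_ne (F.le_max' b hb) hb'.2)

theorem IsIndependenceComplex.pair_mem_iff (hΔ : IsIndependenceComplex n P Δ) {a b : ℕ}
    (ha : 1 ≤ a) (hab : a < b) (hb : b ≤ n) : {a, b} ∈ Δ.faces ↔ ¬ P a b := by
  rw [hΔ]
  constructor
  · exact fun h => h.2 a (by simp) b (by simp) hab
  · intro h
    refine ⟨fun x hx => ?_, fun x hx y hy hxy => ?_⟩
    · simp only [mem_insert, mem_singleton] at hx
      rw [mem_Icc]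
      omega
    · simp only [mem_insert, mem_singleton] at hx hy
      obtain ⟨rfl, rfl⟩ : x = a ∧ y = b := by omega
      exact h

theorem IsIndependenceComplex.empty_mem (hΔ : IsIndependenceComplex n P Δ) : ∅ ∈ Δ.faces :=
  (hΔ _).mpr (by simp)

theorem IsIndependenceComplex.isFacet (hΔ : IsIndependenceComplex n P Δ) {F : Finset ℕ}
    (hF : F ⊆ Icc 1 n) (hind : ∀ a ∈ F, ∀ b ∈ F, a < b → ¬ P a b)
    (hmax : ∀ x, 1 ≤ x → x ≤ n → x ∉ F → ∃ y ∈ F, (x < y ∧ P x y) ∨ (y < x ∧ P y x)) :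
    Δ.IsFacet F := by
  refine ⟨(hΔ F).mpr ⟨hF, hind⟩, fun G hG hFG => hFG.antisymm fun x hx => ?_⟩
  by_contra hxF
  obtain ⟨hGn, hG⟩ := (hΔ G).mp hG
  have := mem_Icc.mp (hGn hx)
  obtain ⟨y, hy, ⟨hxy, h⟩ | ⟨hxy, h⟩⟩ := hmax x this.1 this.2 hxF
  · exact hG x hx y (hFG hy) hxy h
  · exact hG y (hFG hy) x hx hxy h

/-- An independence complex of dimension one is generated by its edges. -/
theorem IsIndependenceComplex.eq_generatedComplex (hΔ : IsIndependenceComplex n P Δ)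
    (hn : 1 ≤ n)
    (htri : ∀ a b c, 1 ≤ a → a < b → b < c → c ≤ n → P a b ∨ P b c ∨ P a c)
    (hvert : ∀ a, 1 ≤ a → a ≤ n → ∃ b, 1 ≤ b ∧ b ≤ n ∧ ((a < b ∧ ¬ P a b) ∨ (b < a ∧ ¬ P b a))) :
    Δ = generatedComplex (nonedges n P) := by
  have hvert' : ∀ a, 1 ≤ a → a ≤ n → ∃ e ∈ nonedges n P, {a} ⊆ e := by
    intro a ha han
    obtain ⟨b, hb, hbn, ⟨h, h'⟩ | ⟨h, h'⟩⟩ := hvert a ha han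
    · exact ⟨{a, b}, ⟨a, b, ha, h, hbn, h', rfl⟩, by simp⟩
    · exact ⟨{b, a}, ⟨b, a, hb, h, han, h', rfl⟩, by simp⟩
  have hfaces : Δ.faces = (generatedComplex (nonedges n P)).faces := by
    ext F
    constructor
    · intro hF
      obtain ⟨hFn, hFP⟩ := (hΔ F).mp hF
      have hcard : F.card ≤ 2 := card_le_two_of_forall_lt fun a ha b hb c hc hab hbc => by
        rcases htri a b c (mem_Icc.mp (hFn ha)).1 hab hbc (mem_Icc.mp (hFn hc)).2 with h | h | h
        · exact hFP a ha b hb hab h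
        · exact hFP b hb c hc hbc h
        · exact hFP a ha c hc (hab.trans hbc) h
      obtain h | h | h : F.card = 0 ∨ F.card = 1 ∨ F.card = 2 := by omega
      · obtain ⟨e, he, -⟩ := hvert' 1 le_rfl hn
        exact ⟨e, he, by simp [card_eq_zero.mp h]⟩
      · obtain ⟨a, rfl⟩ := card_eq_one.mp h
        have := mem_Icc.mp (hFn (mem_singleton_self a))
        exact hvert' a this.1 this.2
      · obtain ⟨a, b, hab, rfl⟩ := card_eq_two.mp h
        have ha : a ∈ ({a, b} : Finset ℕ) := by simp
        have hb : b ∈ ({a, b} : Finset ℕ) := by simp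
        have ha' := mem_Icc.mp (hFn ha)
        have hb' := mem_Icc.mp (hFn hb)
        rcases lt_or_gt_of_ne hab with h | h
        · exact ⟨_, ⟨a, b, ha'.1, h, hb'.2, hFP a ha b hb h, rfl⟩, subset_rfl⟩
        · exact ⟨_, ⟨b, a, hb'.1, h, ha'.2, hFP b hb a ha h, pair_comm a b⟩, subset_rfl⟩
    · rintro ⟨_, ⟨a, b, ha, hab, hb, hP, rfl⟩, hF⟩
      exact Δ.down_closed ((hΔ.pair_mem_iff ha hab hb).mpr hP) hF
  cases Δ
  simpa [generatedComplex] using hfaces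

theorem isCMtW_one_generatedComplex_nonedges (k : Type*) [Field k] (n : ℕ)
    (P : ℕ → ℕ → Prop) : IsCMtW k (Icc 1 n) 1 (generatedComplex (nonedges n P)) := by
  have hcard : ∀ e ∈ nonedges n P, e ⊆ Icc 1 n ∧ e.card = 2 := by
    rintro _ ⟨a, b, ha, hab, hb, -, rfl⟩
    refine ⟨fun x hx => ?_, card_pair hab.ne⟩
    simp only [mem_insert, mem_singleton] at hx
    rw [mem_Icc]
    omega
  refine isCMtW_one_of_graph ?_ ?_ ?_
  · rintro F ⟨e, he, hF⟩
    exact hF.trans (hcard e he).1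
  · rintro F ⟨e, he, hF⟩
    exact (card_le_card hF).trans (hcard e he).2.le
  · rintro F ⟨e, he, hF⟩
    exact ⟨e, ⟨e, he, subset_rfl⟩, hF, (hcard e he).2⟩

/-- A vertex in no edge of the graph is an apex of the independence complex, so a Buchsbaum
complex having such a vertex is Cohen–Macaulay. -/
theorem IsIndependenceComplex.isCMW_of_isolated {k : Type*} [Field k]
    (hΔ : IsIndependenceComplex n P Δ) (hB : IsCMtW k (Icc 1 n) 1 Δ) {c : ℕ}
    (hc₁ : 1 ≤ c) (hcn : c ≤ n) (hlt : ∀ x, 1 ≤ x → x < c → ¬ P x c)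
    (hgt : ∀ x, c < x → x ≤ n → ¬ P c x) : IsCMW k (Icc 1 n) Δ := by
  have hcone : ∀ F ∈ Δ.faces, insert c F ∈ Δ.faces := by
    intro F hF
    obtain ⟨hFn, hFP⟩ := (hΔ F).mp hF
    refine (hΔ _).mpr ⟨insert_subset (mem_Icc.mpr ⟨hc₁, hcn⟩) hFn, fun a ha b hb hab => ?_⟩
    obtain rfl | haF := mem_insert.mp ha
    · obtain rfl | hbF := mem_insert.mp hb
      · exact absurd hab (lt_irrefl _)
      · exact hgt b hab (mem_Icc.mp (hFn hbF)).2
    · obtain rfl | hbF := mem_insert.mp hb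
      · exact hlt a (mem_Icc.mp (hFn haF)).1 hab
      · exact hFP a haF b hbF hab
  refine isCMW_of_isCMW_link (mem_Icc.mpr ⟨hc₁, hcn⟩) hΔ.empty_mem hcone
    (hB.2 {c} ?_ (by simp))
  simpa using hcone ∅ hΔ.empty_mem

end FlagComplexes

section Caterpillars

variable {k : Type*} [Field k]

theorem regularModIdeal_simplexOn_of_pair {n a b : ℕ} (ha : a = 1 ∨ a = n) (hb : 2 ≤ b)
    (hbn : b + 1 ≤ n) :
    RegularModIdeal (srIdealW k (Icc 1 n) (SComplex.simplexOn {a, b}))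
      [linearForm k (Icc 1 n) {1, n}, linearForm k (Icc 1 n) (Icc 2 (n - 1))] := by
  refine regularModIdeal_simplexOn_pair (a := a) (b := b) ?_ (by simpa using ha) (by simp) ?_
    (by rw [mem_Icc]; omega) (by simp) ?_ (by omega)
  · intro x hx
    simp only [mem_insert, mem_singleton] at hx
    rw [mem_Icc]
    omega
  all_goals
    intro v hv hve
    simp only [mem_insert, mem_singleton, mem_Icc] at hv hve
    omega

/-- Attaching leaves to the vertex `1` of a bipartite graph with parts `{1, n}` and
`{2, …, n - 1}`. -/
theorem isCMW_generatedComplex_union_leaves {n : ℕ} {E : Set (Finset ℕ)} {L : Finset ℕ}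
    (hE : RegularModIdeal (srIdealW k (Icc 1 n) (generatedComplex E))
      [linearForm k (Icc 1 n) {1, n}, linearForm k (Icc 1 n) (Icc 2 (n - 1))])
    (hpair : ∀ e ∈ E, ∃ a b, (a = 1 ∨ a = n) ∧ 2 ≤ b ∧ b + 1 ≤ n ∧ e = {a, b})
    (hE1 : ∃ e ∈ E, 1 ∈ e) (hL : ∀ a ∈ L, 2 ≤ a ∧ a + 1 ≤ n) (hLE : ∀ a ∈ L, ∀ e ∈ E, a ∉ e) :
    IsCMW k (Icc 1 n) (generatedComplex (E ∪ {e | ∃ a ∈ L, e = {1, a}})) := by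
  have hpair' : ∀ e ∈ E ∪ {e | ∃ a ∈ L, e = {1, a}},
      ∃ a b, (a = 1 ∨ a = n) ∧ 2 ≤ b ∧ b + 1 ≤ n ∧ e = {a, b} := by
    rintro e (he | ⟨a, ha, rfl⟩)
    · exact hpair e he
    · exact ⟨1, a, Or.inl rfl, (hL a ha).1, (hL a ha).2, rfl⟩
  have hn : 1 ≤ n := by
    obtain ⟨e, he, -⟩ := hE1
    obtain ⟨a, b, -, h, h', -⟩ := hpair e he
    omega
  refine isCMW_generatedComplex_of_regularModIdeal (d := 2) ?_ ?_ ?_ (by simp) ?_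
    (regularModIdeal_generatedComplex_leaves (mem_Icc.mpr ⟨le_rfl, hn⟩) (fun a ha => ?_) hE1 hLE
      (fun h => ?_) (fun a ha => ?_) hE)
  · obtain ⟨e, he, -⟩ := hE1
    exact ⟨e, Or.inl he⟩
  · intro e he x hx
    obtain ⟨a, b, ha, hb, hbn, rfl⟩ := hpair' e he
    simp only [mem_insert, mem_singleton] at hx
    rw [mem_Icc]
    omega
  · intro e he
    obtain ⟨a, b, ha, hb, hbn, rfl⟩ := hpair' e he
    exact card_pair (by omega)
  · intro r hr
    simp only [List.mem_cons, List.not_mem_nil, or_false] at hr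
    rcases hr with rfl | rfl <;> exact linearForm_mem_span _
  · have := hL a ha
    rw [mem_Icc]
    omega
  · have := hL 1 h
    omega
  · exact regularModIdeal_simplexOn_of_pair (Or.inl rfl) (hL a ha).1 (hL a ha).2

/-- The path `1, n - 1, n` with leaves attached to `1`. -/
theorem isCMW_short_path_with_leaves (m : ℕ) :
    IsCMW k (Icc 1 (m + 4)) (generatedComplex
      (insert {1, m + 3} {{m + 4, m + 3}} ∪ {e | ∃ a ∈ Icc 2 (m + 2), e = {1, a}})) := by
  refine isCMW_generatedComplex_union_leaves ?_ ?_ ⟨{1, m + 3}, by simp⟩ ?_ ?_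
  · refine regularModIdeal_generatedComplex_insert (R := {1}) ?_ ?_ ?_ ?_
      (regularModIdeal_simplexOn_of_pair (by omega) (by omega) (by omega))
      (regularModIdeal_generatedComplex_singleton
        (regularModIdeal_simplexOn_of_pair (by omega) (by omega) (by omega)))
    · intro x; simp only [mem_insert, mem_singleton, mem_Icc]; omega
    · simp
    · simp
    · simp
  · rintro e (rfl | rfl)
    · exact ⟨1, m + 3, by omega, by omega, by omega, rfl⟩
    · exact ⟨m + 4, m + 3, by omega, by omega, by omega, rfl⟩
  · intro a ha
    rw [mem_Icc] at ha
    omega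
  · rintro a ha e (rfl | rfl) <;> simp only [mem_insert, mem_singleton, mem_Icc] at ha ⊢ <;> omega

theorem regularModIdeal_long_path (m : ℕ) :
    RegularModIdeal (srIdealW k (Icc 1 (m + 4)) (generatedComplex
      (insert {1, m + 2} (insert {m + 4, m + 2} {{m + 4, m + 3}}))))
      [linearForm k (Icc 1 (m + 4)) {1, m + 4},
        linearForm k (Icc 1 (m + 4)) (Icc 2 (m + 4 - 1))] := by
  refine regularModIdeal_generatedComplex_insert (R := {1}) ?_ ?_ ?_ ?_
    (regularModIdeal_simplexOn_of_pair (by omega) (by omega) (by omega))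
    (regularModIdeal_generatedComplex_insert (R := {m + 2}) ?_ ?_ ?_ ?_
      (regularModIdeal_simplexOn_of_pair (by omega) (by omega) (by omega))
      (regularModIdeal_generatedComplex_singleton
        (regularModIdeal_simplexOn_of_pair (by omega) (by omega) (by omega))))
  · intro x; simp only [mem_insert, mem_singleton, mem_Icc]; omega
  · simp
  · simp
  · simp
  · intro x; simp only [mem_insert, mem_singleton, mem_Icc]; omega
  · simp
  · simp
  · intro v hv
    refine ⟨_, rfl, fun x hx => ?_⟩
    simp only [mem_erase, mem_insert, mem_singleton] at hv hx ⊢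
    omega

/-- The path `1, n - 2, n, n - 1` with leaves attached to `1`. -/
theorem isCMW_long_path_with_leaves (m : ℕ) :
    IsCMW k (Icc 1 (m + 4)) (generatedComplex
      (insert {1, m + 2} (insert {m + 4, m + 2} {{m + 4, m + 3}}) ∪
        {e | ∃ a ∈ Icc 2 (m + 1), e = {1, a}})) := by
  refine isCMW_generatedComplex_union_leaves (regularModIdeal_long_path m) ?_
    ⟨{1, m + 2}, by simp⟩ ?_ ?_
  · rintro e (rfl | rfl | rfl)
    · exact ⟨1, m + 2, by omega, by omega, by omega, rfl⟩
    · exact ⟨m + 4, m + 2, by omega, by omega, by omega, rfl⟩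
    · exact ⟨m + 4, m + 3, by omega, by omega, by omega, rfl⟩
  · intro a ha
    rw [mem_Icc] at ha
    omega
  · rintro a ha e (rfl | rfl | rfl) <;>
      simp only [mem_insert, mem_singleton, mem_Icc] at ha ⊢ <;> omega

/-- The 4-cycle `1, n - 2, n, n - 1` with leaves attached to `1`. -/
theorem isCMW_cycle_with_leaves (m : ℕ) :
    IsCMW k (Icc 1 (m + 4)) (generatedComplex
      (insert {1, m + 3} (insert {1, m + 2} (insert {m + 4, m + 2} {{m + 4, m + 3}})) ∪
        {e | ∃ a ∈ Icc 2 (m + 1), e = {1, a}})) := by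
  refine isCMW_generatedComplex_union_leaves
    (regularModIdeal_generatedComplex_insert (R := {1, m + 3}) ?_ subset_rfl ?_ ?_
      (regularModIdeal_simplexOn_of_pair (by omega) (by omega) (by omega))
      (regularModIdeal_long_path m)) ?_ ⟨{1, m + 2}, by simp⟩ ?_ ?_
  · intro x; simp only [mem_insert, mem_singleton, mem_Icc]; omega
  · rintro e (rfl | rfl | rfl) <;> simp [insert_subset_iff]
  · intro v hv
    simp only [mem_insert, mem_singleton] at hv
    rcases hv with rfl | rfl
    · refine ⟨{m + 4, m + 3}, by simp, fun x hx => ?_⟩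
      simp only [mem_erase, mem_insert, mem_singleton] at hx ⊢
      omega
    · refine ⟨{1, m + 2}, by simp, fun x hx => ?_⟩
      simp only [mem_erase, mem_insert, mem_singleton] at hx ⊢
      omega
  · rintro e (rfl | rfl | rfl | rfl)
    · exact ⟨1, m + 3, by omega, by omega, by omega, rfl⟩
    · exact ⟨1, m + 2, by omega, by omega, by omega, rfl⟩
    · exact ⟨m + 4, m + 2, by omega, by omega, by omega, rfl⟩
    · exact ⟨m + 4, m + 3, by omega, by omega, by omega, rfl⟩
  · intro a ha
    rw [mem_Icc] at ha
    omega
  · rintro a ha e (rfl | rfl | rfl | rfl) <;>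
      simp only [mem_insert, mem_singleton, mem_Icc] at ha ⊢ <;> omega

end Caterpillars

section LexSegments

/-- The pair `a < b` lies in the lexsegment from `{i, j}` to `{r, s}`. -/
def LexBetween (i j r s a b : ℕ) : Prop :=
  (i < a ∨ i = a ∧ j ≤ b) ∧ (a < r ∨ a = r ∧ b ≤ s)

theorem lexGT_pair_iff {i j a b : ℕ} (hij : i < j) (hab : a < b) :
    lexGT {i, j} {a, b} ↔ i < a ∨ i = a ∧ j < b := by
  simp only [lexGT, mem_insert, mem_singleton]
  constructor
  · rintro ⟨m, hm, hm', h⟩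
    have h₁ := h i
    have h₂ := h a
    have h₃ := h b
    omega
  · rintro (h | ⟨rfl, h⟩)
    · exact ⟨i, by omega, by omega, fun x hx => by omega⟩
    · exact ⟨j, by omega, by omega, fun x hx => by omega⟩

theorem lexGE_pair_iff {i j a b : ℕ} (hij : i < j) (hab : a < b) :
    lexGE {i, j} {a, b} ↔ i < a ∨ i = a ∧ j ≤ b := by
  rw [lexGE, lexGT_pair_iff hij hab]
  constructor
  · rintro (h | h)
    · have hi : i ∈ ({a, b} : Finset ℕ) := h ▸ by simp
      have hj : j ∈ ({a, b} : Finset ℕ) := h ▸ by simp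
      simp only [mem_insert, mem_singleton] at hi hj
      omega
    · omega
  · intro h
    by_cases h' : i = a ∧ j = b
    · exact Or.inl (by rw [h'.1, h'.2])
    · exact Or.inr (by omega)

theorem exists_mem_lexSegment_subset_iff {n i j r s : ℕ} (hij : i < j) (hrs : r < s)
    {F : Finset ℕ} (hF : F ⊆ Icc 1 n) :
    (∃ S ∈ lexSegment n 2 {i, j} {r, s}, S ⊆ F) ↔
      ∃ a ∈ F, ∃ b ∈ F, a < b ∧ LexBetween i j r s a b := by
  constructor
  · rintro ⟨S, ⟨-, hS, h₁, h₂⟩, hSF⟩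
    obtain ⟨a, b, hab, rfl⟩ : ∃ a b, a < b ∧ S = {a, b} := by
      obtain ⟨a, b, hab, rfl⟩ := card_eq_two.mp hS
      rcases lt_or_gt_of_ne hab with h | h
      · exact ⟨a, b, h, rfl⟩
      · exact ⟨b, a, h, pair_comm a b⟩
    exact ⟨a, hSF (by simp), b, hSF (by simp), hab, (lexGE_pair_iff hij hab).mp h₁,
      (lexGE_pair_iff hab hrs).mp h₂⟩
  · rintro ⟨a, ha, b, hb, hab, h₁, h₂⟩
    have hsub : ({a, b} : Finset ℕ) ⊆ F := by simp [insert_subset_iff, ha, hb]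
    exact ⟨{a, b}, ⟨hsub.trans hF, card_pair hab.ne, (lexGE_pair_iff hij hab).mpr h₁,
      (lexGE_pair_iff hab hrs).mpr h₂⟩, hsub⟩

theorem isIndependenceComplex_of_srIdealW_eq {k : Type*} [Field k] {n i j r s : ℕ}
    (hij : i < j) (hrs : r < s) {Δ : SComplex ℕ} (hΔsub : ∀ F ∈ Δ.faces, F ⊆ Icc 1 n)
    (hΔ : srIdealW k (Icc 1 n) Δ = lexIdealW k (Icc 1 n) n 2 {i, j} {r, s}) :
    IsIndependenceComplex n (LexBetween i j r s) Δ := by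
  classical
  have key : ∀ F ⊆ Icc 1 n, (F ∉ Δ.faces ↔
      ∃ a ∈ F, ∃ b ∈ F, a < b ∧ LexBetween i j r s a b) := by
    intro F hF
    rw [← exists_mem_lexSegment_subset_iff hij hrs hF, ← monoW_mem_srIdealW_iff (k := k) hF, hΔ,
      lexIdealW, mem_span_monoW_iff fun S hS => hS.1, monoW_eq_monomial,
      MvPolynomial.support_monomial, if_neg one_ne_zero]
    simp only [mem_singleton, forall_eq, exponentSupport_squarefreeExponent hF]
  intro F
  constructor
  · intro hF
    refine ⟨hΔsub F hF, fun a ha b hb hab h => ?_⟩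
    exact (key F (hΔsub F hF)).mpr ⟨a, ha, b, hb, hab, h⟩ hF
  · rintro ⟨hFn, hF⟩
    by_contra hFΔ
    obtain ⟨a, ha, b, hb, hab, h⟩ := (key F hFn).mp hFΔ
    exact hF a ha b hb hab h

theorem nonedges_short_path (m : ℕ) :
    nonedges (m + 4) (LexBetween 1 (m + 4) (m + 2) (m + 4)) =
      insert {1, m + 3} {{m + 4, m + 3}} ∪ {e | ∃ a ∈ Icc 2 (m + 2), e = {1, a}} := by
  ext e
  constructor
  · rintro ⟨a, b, ha, hab, hb, h, rfl⟩
    unfold LexBetween at h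
    obtain ⟨rfl, rfl⟩ | ⟨rfl, rfl⟩ | ⟨rfl, h₂⟩ : (a = 1 ∧ b = m + 3) ∨ (a = m + 3 ∧ b = m + 4) ∨
        (a = 1 ∧ b ≤ m + 2) := by omega
    · exact Or.inl (Or.inl rfl)
    · exact Or.inl (Or.inr (pair_comm _ _))
    · exact Or.inr ⟨b, mem_Icc.mpr ⟨hab, h₂⟩, rfl⟩
  · unfold nonedges LexBetween
    rintro ((rfl | rfl) | ⟨a, ha, rfl⟩)
    · exact ⟨1, m + 3, by omega, by omega, by omega, by omega, rfl⟩
    · exact ⟨m + 3, m + 4, by omega, by omega, by omega, by omega, pair_comm _ _⟩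
    · rw [mem_Icc] at ha
      exact ⟨1, a, by omega, by omega, by omega, by omega, rfl⟩

theorem nonedges_long_path (m : ℕ) :
    nonedges (m + 4) (LexBetween 1 (m + 3) (m + 2) (m + 3)) =
      insert {1, m + 2} (insert {m + 4, m + 2} {{m + 4, m + 3}}) ∪
        {e | ∃ a ∈ Icc 2 (m + 1), e = {1, a}} := by
  ext e
  constructor
  · rintro ⟨a, b, ha, hab, hb, h, rfl⟩
    unfold LexBetween at h
    obtain ⟨rfl, rfl⟩ | ⟨rfl, rfl⟩ | ⟨rfl, rfl⟩ | ⟨rfl, h₂⟩ : (a = 1 ∧ b = m + 2) ∨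
        (a = m + 2 ∧ b = m + 4) ∨ (a = m + 3 ∧ b = m + 4) ∨ (a = 1 ∧ b ≤ m + 1) := by omega
    · exact Or.inl (Or.inl rfl)
    · exact Or.inl (Or.inr (Or.inl (pair_comm _ _)))
    · exact Or.inl (Or.inr (Or.inr (pair_comm _ _)))
    · exact Or.inr ⟨b, mem_Icc.mpr ⟨hab, h₂⟩, rfl⟩
  · unfold nonedges LexBetween
    rintro ((rfl | rfl | rfl) | ⟨a, ha, rfl⟩)
    · exact ⟨1, m + 2, by omega, by omega, by omega, by omega, rfl⟩
    · exact ⟨m + 2, m + 4, by omega, by omega, by omega, by omega, pair_comm _ _⟩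
    · exact ⟨m + 3, m + 4, by omega, by omega, by omega, by omega, pair_comm _ _⟩
    · rw [mem_Icc] at ha
      exact ⟨1, a, by omega, by omega, by omega, by omega, rfl⟩

theorem nonedges_cycle (m : ℕ) :
    nonedges (m + 4) (LexBetween 1 (m + 4) (m + 2) (m + 3)) =
      insert {1, m + 3} (insert {1, m + 2} (insert {m + 4, m + 2} {{m + 4, m + 3}})) ∪
        {e | ∃ a ∈ Icc 2 (m + 1), e = {1, a}} := by
  ext e
  constructor
  · rintro ⟨a, b, ha, hab, hb, h, rfl⟩
    unfold LexBetween at h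
    obtain ⟨rfl, rfl⟩ | ⟨rfl, rfl⟩ | ⟨rfl, rfl⟩ | ⟨rfl, rfl⟩ | ⟨rfl, h₂⟩ :
        (a = 1 ∧ b = m + 3) ∨ (a = 1 ∧ b = m + 2) ∨ (a = m + 2 ∧ b = m + 4) ∨
          (a = m + 3 ∧ b = m + 4) ∨ (a = 1 ∧ b ≤ m + 1) := by omega
    · exact Or.inl (Or.inl rfl)
    · exact Or.inl (Or.inr (Or.inl rfl))
    · exact Or.inl (Or.inr (Or.inr (Or.inl (pair_comm _ _))))
    · exact Or.inl (Or.inr (Or.inr (Or.inr (pair_comm _ _))))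
    · exact Or.inr ⟨b, mem_Icc.mpr ⟨hab, h₂⟩, rfl⟩
  · unfold nonedges LexBetween
    rintro ((rfl | rfl | rfl | rfl) | ⟨a, ha, rfl⟩)
    · exact ⟨1, m + 3, by omega, by omega, by omega, by omega, rfl⟩
    · exact ⟨1, m + 2, by omega, by omega, by omega, by omega, rfl⟩
    · exact ⟨m + 2, m + 4, by omega, by omega, by omega, by omega, pair_comm _ _⟩
    · exact ⟨m + 3, m + 4, by omega, by omega, by omega, by omega, pair_comm _ _⟩
    · rw [mem_Icc] at ha
      exact ⟨1, a, by omega, by omega, by omega, by omega, rfl⟩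

theorem isCMW_of_lexBetween {k : Type*} [Field k] {m j s : ℕ} {Δ : SComplex ℕ}
    (hΔ : IsIndependenceComplex (m + 4) (LexBetween 1 j (m + 2) s) Δ)
    (hjs : (j = m + 4 ∧ s = m + 4) ∨ (j = m + 3 ∧ s = m + 3) ∨ (j = m + 4 ∧ s = m + 3)) :
    IsCMW k (Icc 1 (m + 4)) Δ := by
  have hgen : Δ = generatedComplex (nonedges (m + 4) (LexBetween 1 j (m + 2) s)) := by
    refine hΔ.eq_generatedComplex (by omega) (fun a b c ha hab hbc hc => ?_) fun a ha han => ?_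
    · unfold LexBetween
      omega
    · unfold LexBetween
      by_cases h : a ≤ m + 2
      · by_cases h₁ : a = 1
        · exact ⟨2, by omega, by omega, by omega⟩
        · exact ⟨1, by omega, by omega, by omega⟩
      · by_cases h₁ : a = m + 3
        · exact ⟨m + 4, by omega, by omega, by omega⟩
        · exact ⟨m + 3, by omega, by omega, by omega⟩
  rcases hjs with ⟨rfl, rfl⟩ | ⟨rfl, rfl⟩ | ⟨rfl, rfl⟩
  · rw [hgen, nonedges_short_path]
    exact isCMW_short_path_with_leaves m
  · rw [hgen, nonedges_long_path]
    exact isCMW_long_path_with_leaves m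
  · rw [hgen, nonedges_cycle]
    exact isCMW_cycle_with_leaves m

variable {n i j r s : ℕ} {Δ : SComplex ℕ}

theorem IsIndependenceComplex.isFacet_pair {P : ℕ → ℕ → Prop} (hΔ : IsIndependenceComplex n P Δ)
    {a b : ℕ} (ha : 1 ≤ a) (hab : a < b) (hb : b ≤ n) (hP : ¬ P a b)
    (hmax : ∀ x, 1 ≤ x → x ≤ n → x ≠ a → x ≠ b → (x < a ∧ P x a) ∨ (a < x ∧ P a x) ∨
      (x < b ∧ P x b) ∨ (b < x ∧ P b x)) : Δ.IsFacet {a, b} := by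
  refine hΔ.isFacet (insert_subset (mem_Icc.mpr ⟨ha, by omega⟩)
    (singleton_subset_iff.mpr (mem_Icc.mpr ⟨by omega, hb⟩))) (fun x hx y hy hxy => ?_)
    fun x hx hxn hxF => ?_
  · simp only [mem_insert, mem_singleton] at hx hy
    obtain ⟨rfl, rfl⟩ : x = a ∧ y = b := by omega
    exact hP
  · simp only [mem_insert, mem_singleton, not_or] at hxF
    rcases hmax x hx hxn hxF.1 hxF.2 with h | h | h | h
    · exact ⟨a, by simp, Or.inl h⟩
    · exact ⟨a, by simp, Or.inr h⟩
    · exact ⟨b, by simp, Or.inl h⟩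
    · exact ⟨b, by simp, Or.inr h⟩

theorem IsIndependenceComplex.isFacet_singleton {P : ℕ → ℕ → Prop}
    (hΔ : IsIndependenceComplex n P Δ) {a : ℕ} (ha : 1 ≤ a) (han : a ≤ n)
    (hmax : ∀ x, 1 ≤ x → x ≤ n → x ≠ a → (x < a ∧ P x a) ∨ (a < x ∧ P a x)) :
    Δ.IsFacet {a} := by
  refine hΔ.isFacet (singleton_subset_iff.mpr (mem_Icc.mpr ⟨ha, han⟩)) (fun x hx y hy hxy => ?_)
    fun x hx hxn hxF => ?_
  · rw [mem_singleton] at hx hy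
    omega
  · exact ⟨a, mem_singleton_self a, hmax x hx hxn (by simpa using hxF)⟩

theorem IsIndependenceComplex.isCMW_of_complete {k : Type*} [Field k] {P : ℕ → ℕ → Prop}
    (hΔ : IsIndependenceComplex n P Δ) (hn : 1 ≤ n)
    (hP : ∀ a b, 1 ≤ a → a < b → b ≤ n → P a b) : IsCMW k (Icc 1 n) Δ := by
  refine isCMW_of_card_le_one (v := 1) (fun F hF => ((hΔ F).mp hF).1) (fun F hF => ?_)
    ((hΔ _).mpr ⟨?_, fun x hx y hy hxy => ?_⟩)
  · obtain ⟨hFn, hF⟩ := (hΔ F).mp hF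
    refine card_le_one.mpr fun a ha b hb => ?_
    have ha' := mem_Icc.mp (hFn ha)
    have hb' := mem_Icc.mp (hFn hb)
    by_contra hab
    rcases lt_or_gt_of_ne hab with h | h
    · exact hF a ha b hb h (hP a b ha'.1 h hb'.2)
    · exact hF b hb a ha h (hP b a hb'.1 h ha'.2)
  · exact singleton_subset_iff.mpr (mem_Icc.mpr ⟨le_rfl, hn⟩)
  · rw [mem_singleton] at hx hy
    omega

theorem isFacet_Ioc_of_lexBetween (hΔ : IsIndependenceComplex n (LexBetween 1 j r s) Δ)
    (hr : 1 ≤ r) (hrs : r < s) (hs : s ≤ n) (hj : j ≤ n) (hjs : r = 1 → j ≤ s) :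
    Δ.IsFacet (Ioc r n) := by
  refine hΔ.isFacet (fun x hx => ?_) (fun a ha b hb hab => ?_) fun x hx hxn hxF => ?_
  · rw [mem_Ioc] at hx
    rw [mem_Icc]
    omega
  · rw [mem_Ioc] at ha
    unfold LexBetween
    omega
  · rw [mem_Ioc] at hxF
    unfold LexBetween
    by_cases h : x = r
    · exact ⟨s, mem_Ioc.mpr (by omega), by omega⟩
    · exact ⟨n, mem_Ioc.mpr (by omega), by omega⟩

theorem isFacet_insert_Ioc_of_lexBetween
    (hΔ : IsIndependenceComplex n (LexBetween 1 j r s) Δ)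
    (hr : 2 ≤ r) (hrs : r < s) (hs : s ≤ n) (hj : j ≤ n) (hjs : j ≤ r ∨ s < n) :
    Δ.IsFacet (insert r (Ioc s n)) := by
  refine hΔ.isFacet (fun x hx => ?_) (fun a ha b hb hab => ?_) fun x hx hxn hxF => ?_
  · rw [mem_insert, mem_Ioc] at hx
    rw [mem_Icc]
    omega
  · rw [mem_insert, mem_Ioc] at ha hb
    unfold LexBetween
    omega
  · rw [mem_insert, mem_Ioc] at hxF
    unfold LexBetween
    by_cases h : x < r ∧ s < n
    · exact ⟨n, mem_insert_of_mem (mem_Ioc.mpr (by omega)), by omega⟩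
    · exact ⟨r, mem_insert_self _ _, by omega⟩

theorem isFacet_insert_insert_Ico_of_lexBetween
    (hΔ : IsIndependenceComplex n (LexBetween 1 j 2 3) Δ) (hj : 2 < j) (hjn : j ≤ n) :
    Δ.IsFacet (insert 1 (insert 2 (Ico 4 j))) := by
  refine hΔ.isFacet (fun x hx => ?_) (fun a ha b hb hab => ?_) fun x hx hxn hxF => ?_
  · rw [mem_insert, mem_insert, mem_Ico] at hx
    rw [mem_Icc]
    omega
  · rw [mem_insert, mem_insert, mem_Ico] at ha hb
    unfold LexBetween
    omega
  · rw [mem_insert, mem_insert, mem_Ico] at hxF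
    unfold LexBetween
    by_cases h : x = 3
    · exact ⟨2, by simp, by omega⟩
    · exact ⟨1, by simp, by omega⟩

theorem isCMtW_one_of_lexBetween {k : Type*} [Field k]
    (hΔ : IsIndependenceComplex n (LexBetween i j r s) Δ)
    (h : (i = 1 ∧ j = n - 2 ∧ r = n - 2 ∧ s = n - 1 ∧ 4 < n) ∨
      (i = 1 ∧ j = n - 1 ∧ r = n - 2 ∧ s = n ∧ 3 < n)) : IsCMtW k (Icc 1 n) 1 Δ := by
  rw [hΔ.eq_generatedComplex (by omega) (fun a b c ha hab hbc hc => ?_) fun a ha han => ?_]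
  · exact isCMtW_one_generatedComplex_nonedges k n _
  · unfold LexBetween
    omega
  · unfold LexBetween
    by_cases h₁ : a = 1
    · exact ⟨2, by omega, by omega, by omega⟩
    by_cases h₂ : a < j
    · exact ⟨1, by omega, by omega, by omega⟩
    by_cases h₃ : a = n
    · exact ⟨n - 1, by omega, by omega, by omega⟩
    · exact ⟨n, by omega, by omega, by omega⟩

theorem eq_or_eq_of_isCMtW_one_of_lexBetween {k : Type*} [Field k]
    (hΔ : IsIndependenceComplex n (LexBetween i j r s) Δ) (hi : 1 ≤ i) (hij : i < j) (hj : j ≤ n)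
    (hrs : r < s) (hs : s ≤ n) (huv : i < r ∨ i = r ∧ j < s)
    (hNCM : ¬ IsCMW k (Icc 1 n) Δ) (hB : IsCMtW k (Icc 1 n) 1 Δ) :
    (i = 1 ∧ j = n - 2 ∧ r = n - 2 ∧ s = n - 1 ∧ 4 < n) ∨
      (i = 1 ∧ j = n - 1 ∧ r = n - 2 ∧ s = n ∧ 3 < n) := by
  have hisol : ∀ c, 1 ≤ c → c ≤ n → (∀ x, 1 ≤ x → x < c → ¬ LexBetween i j r s x c) →
      ¬ ∀ x, c < x → x ≤ n → ¬ LexBetween i j r s c x :=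
    fun c h₁ h₂ h₃ h₄ => hNCM (hΔ.isCMW_of_isolated hB h₁ h₂ h₃ h₄)
  obtain rfl : i = 1 := by
    by_contra hi1
    refine hisol 1 le_rfl (by omega) (fun x hx hx' => by omega) fun x hx hxn => ?_
    unfold LexBetween
    omega
  have hcomplete : ¬ ∀ a b, 1 ≤ a → a < b → b ≤ n → LexBetween 1 j r s a b :=
    fun h => hNCM (hΔ.isCMW_of_complete (by omega) h)
  have hcard : ∀ F, Δ.IsFacet F → F.card = n - r := fun F hF => by
    rw [hB.1 hF (isFacet_Ioc_of_lexBetween hΔ (by omega) hrs hs hj (by omega)), Nat.card_Ioc]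
  obtain rfl | hr : r = 1 ∨ 2 ≤ r := by omega
  · exfalso
    obtain rfl : j = 2 := by
      by_contra hj2
      refine hisol 2 (by omega) (by omega) (fun x hx hx' => ?_) fun x hx hxn => ?_ <;>
        unfold LexBetween <;> omega
    obtain rfl : s = n := by
      by_contra hsn
      refine hisol n (by omega) le_rfl (fun x hx hx' => ?_) fun x hx hxn => ?_ <;>
        unfold LexBetween <;> omega
    have h1 := hcard {1} (hΔ.isFacet_singleton le_rfl (by omega) fun x hx hxn hx1 => by
      unfold LexBetween; omega)
    rw [card_singleton] at h1
    refine hcomplete fun a b ha hab hb => ?_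
    unfold LexBetween
    omega
  obtain rfl | hj2 : j = 2 ∨ 2 < j := by omega
  · exfalso
    have h1 := hcard {1} (hΔ.isFacet_singleton le_rfl (by omega) fun x hx hxn hx1 => by
      unfold LexBetween; omega)
    rw [card_singleton] at h1
    refine hcomplete fun a b ha hab hb => ?_
    unfold LexBetween
    omega
  have hpair : 3 ≤ r ∨ s = n → n - r = 2 := fun h => by
    rw [← hcard {1, 2} (hΔ.isFacet_pair le_rfl (by omega) (by omega) ?_ fun x hx hxn h1 h2 => ?_)]
    · exact card_pair (by omega)
    all_goals
      unfold LexBetween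
      omega
  have hins : j ≤ r ∨ s < n → n - s + 1 = n - r := fun h => by
    rw [← hcard _ (isFacet_insert_Ioc_of_lexBetween hΔ hr hrs hs hj h),
      card_insert_of_notMem (by rw [mem_Ioc]; omega), Nat.card_Ioc]
  have hnr : n = r + 2 := by
    by_cases h : 3 ≤ r ∨ s = n
    · have := hpair h
      omega
    · obtain rfl : r = 2 := by omega
      obtain rfl : s = 3 := by
        have := hins (by omega)
        omega
      have hc := hcard _ (isFacet_insert_insert_Ico_of_lexBetween hΔ hj2 hj)
      rw [card_insert_of_notMem (by rw [mem_insert, mem_Ico]; omega),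
        card_insert_of_notMem (by rw [mem_Ico]; omega), Nat.card_Ico] at hc
      by_contra hn
      refine hisol 4 (by omega) (by omega) (fun x hx hx' => ?_) fun x hx hxn => ?_ <;>
        unfold LexBetween <;> omega
  obtain ⟨m, rfl⟩ : ∃ m, r = m + 2 := ⟨r - 2, by omega⟩
  obtain rfl : n = m + 4 := hnr
  by_cases hjr : j ≤ m + 2
  · have hsr := hins (Or.inl hjr)
    by_cases hjr' : j = m + 2
    · omega
    · have h1 := hcard {j} (hΔ.isFacet_singleton (by omega) hj fun x hx hxn hx1 => by
        unfold LexBetween; omega)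
      rw [card_singleton] at h1
      omega
  · by_cases hb : j = m + 3 ∧ s = m + 4
    · omega
    · exact absurd (isCMW_of_lexBetween hΔ (by omega)) hNCM

end LexSegments

/-- Let `u = xᵢxⱼ > v = xᵣxₛ` and let `Δ` be the associated
lexsegment complex; assume `Δ` is not Cohen–Macaulay over `k`. Then `Δ` is
Buchsbaum iff (a) `u = x₁x₍ₙ₋₂₎`, `v = x₍ₙ₋₂₎x₍ₙ₋₁₎`, `n > 4`, or
(b) `u = x₁x₍ₙ₋₁₎`, `v = x₍ₙ₋₂₎xₙ`, `n > 3`. -/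
theorem lexsegment_buchsbaum_characterization (k : Type*) [Field k] (n i j r s : ℕ) (hij : i < j) (hrs : r < s)
    (hUsub : ({i, j} : Finset ℕ) ⊆ Finset.Icc 1 n)
    (hVsub : ({r, s} : Finset ℕ) ⊆ Finset.Icc 1 n)
    (huv : lexGT {i, j} {r, s})
    (Δ : SComplex ℕ) (hΔsub : ∀ F ∈ Δ.faces, F ⊆ Finset.Icc 1 n)
    (hΔ : srIdealW k (Finset.Icc 1 n) Δ = lexIdealW k (Finset.Icc 1 n) n 2 {i, j} {r, s})
    (hNCM : ¬ IsCMW k (Finset.Icc 1 n) Δ) :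
    IsCMtW k (Finset.Icc 1 n) 1 Δ ↔
      ((i = 1 ∧ j = n - 2 ∧ r = n - 2 ∧ s = n - 1 ∧ 4 < n) ∨
       (i = 1 ∧ j = n - 1 ∧ r = n - 2 ∧ s = n ∧ 3 < n)) := by
  have hind := isIndependenceComplex_of_srIdealW_eq hij hrs hΔsub hΔ
  simp only [insert_subset_iff, singleton_subset_iff, mem_Icc] at hUsub hVsub
  exact ⟨eq_or_eq_of_isCMtW_one_of_lexBetween hind hUsub.1.1 hij hUsub.2.2 hrs hVsub.2.2
    ((lexGT_pair_iff hij hrs).mp huv) hNCM, isCMtW_one_of_lexBetween hind⟩
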